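/- arXiv:2403.13426 — 5 statements merged into one kernel-verified Lean document; each statement's English description precedes it below -/
import Mathlib

section
/- Let n ≥ 3 be an integer, let h satisfy hypotheses (H), and let k ≥ 1 be an integer. Then the Steklov spectral ratio satisfies σ_(k+1)(g_h)/σ_(k)(g_h) < λ_(k+1)/λ_(k) = ((k+1)(n+k−1))/(k(n+k−2)). -/
open MeasureTheory Set

/-- Hypotheses (H): `h` is smooth on `[0,R]`, positive on `[0,R)`, `h(R)=0`,
`h'(R) = -1`, and all even-order derivatives of `h` vanish at `R`. -/
def SatisfiesH (R : ℝ) (h : ℝ → ℝ) : Prop :=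
  ContDiffOn ℝ (⊤ : ℕ∞) h (Set.Icc 0 R) ∧
  (∀ r ∈ Set.Ico (0:ℝ) R, 0 < h r) ∧
  h R = 0 ∧
  derivWithin h (Set.Icc 0 R) R = -1 ∧
  ∀ k : ℕ, iteratedDerivWithin (2 * k) h (Set.Icc 0 R) R = 0

/-- The `k`-th distinct eigenvalue `λ_(k) = k (n + k - 2)` of the Laplacian on the
round unit sphere `S^{n-1}`. -/
noncomputable def sphereEig (n k : ℕ) : ℝ := (k : ℝ) * ((n : ℝ) + (k : ℝ) - 2)

/-- The Rayleigh quotient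
`R_λ(a; h) = (∫₀^R ((a')² h^{n-1} + λ a² h^{n-3}))/(a(0)² h(0)^{n-1})`. -/
noncomputable def rayleighQ (R : ℝ) (n : ℕ) (lam : ℝ) (h a : ℝ → ℝ) : ℝ :=
  (∫ r in (0:ℝ)..R,
      (deriv a r) ^ 2 * h r ^ ((n : ℤ) - 1) + lam * (a r) ^ 2 * h r ^ ((n : ℤ) - 3)) /
    ((a 0) ^ 2 * h 0 ^ ((n : ℤ) - 1))

/-- Admissible test functions: Lipschitz on `[0,R]`, vanishing at `R`, nonzero at `0`. -/
def IsAdmissible (R : ℝ) (a : ℝ → ℝ) : Prop :=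
  (∃ K : NNReal, LipschitzOnWith K a (Set.Icc 0 R)) ∧ a R = 0 ∧ a 0 ≠ 0

/-- The `k`-th distinct Steklov eigenvalue of the ball `[0,R] × S^{n-1}` with the
revolution metric `g_h`, characterized variationally. -/
noncomputable def steklov (R : ℝ) (n k : ℕ) (h : ℝ → ℝ) : ℝ :=
  sInf { v : ℝ | ∃ a : ℝ → ℝ, IsAdmissible R a ∧ v = rayleighQ R n (sphereEig n k) h a }

/-- `a` is a minimizer realizing `σ_(k)(g_h)`. -/
def IsMinimizer (R : ℝ) (n k : ℕ) (h a : ℝ → ℝ) : Prop :=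
  IsAdmissible R a ∧ rayleighQ R n (sphereEig n k) h a = steklov R n k h

namespace SteklovAux

lemma deriv_sq_integrable {R : ℝ} (hR : 0 < R) {a : ℝ → ℝ} {K : NNReal}
    (ha : LipschitzOnWith K a (Icc 0 R)) :
    IntervalIntegrable (fun r => deriv a r ^ 2) volume 0 R := by
  rw [intervalIntegrable_iff_integrableOn_Ioo_of_le hR.le]
  refine IntegrableOn.of_bound (by simp) ((measurable_deriv a).pow_const 2).aestronglyMeasurable
    ((K : ℝ) ^ 2) ?_
  refine (ae_restrict_iff' measurableSet_Ioo).2 (Filter.Eventually.of_forall fun x hx => ?_)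
  have := norm_deriv_le_of_lipschitzOn (Icc_mem_nhds hx.1 hx.2) ha
  rw [norm_pow]
  exact pow_le_pow_left₀ (norm_nonneg _) this 2

lemma a_continuousOn {R : ℝ} (hR : 0 < R) {a : ℝ → ℝ} {K : NNReal}
    (ha : LipschitzOnWith K a (Icc 0 R)) : ContinuousOn a (uIcc 0 R) := by
  rw [uIcc_of_le hR.le]; exact ha.continuousOn

lemma intA {R : ℝ} (hR : 0 < R) {a g : ℝ → ℝ} {K : NNReal} (hg : Continuous g)
    (ha : LipschitzOnWith K a (Icc 0 R)) (m : ℕ) :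
    IntervalIntegrable (fun r => deriv a r ^ 2 * g r ^ (m + 2)) volume 0 R :=
  (deriv_sq_integrable hR ha).mul_continuousOn (hg.pow _).continuousOn

lemma intB {R : ℝ} (hR : 0 < R) {a g : ℝ → ℝ} {K : NNReal} (hg : Continuous g)
    (ha : LipschitzOnWith K a (Icc 0 R)) (m : ℕ) :
    IntervalIntegrable (fun r => a r ^ 2 * g r ^ m) volume 0 R :=
  (((a_continuousOn hR ha).pow 2).mul (hg.pow _).continuousOn).intervalIntegrable

/-- Lower bound on the zeroth order part. -/
lemma lower_bound {R : ℝ} (hR : 0 < R) {g : ℝ → ℝ} (hg : Continuous g) {c0 C0 : ℝ}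
    (hc0 : 0 < c0) (hC0 : 0 < C0)
    (hlo : ∀ r ∈ Icc 0 R, c0 * (R - r) ≤ g r) (hup : ∀ r ∈ Icc 0 R, g r ≤ C0 * (R - r)) (m : ℕ) :
    ∃ K : ℝ, 0 ≤ K ∧ ∀ a : ℝ → ℝ, IsAdmissible R a → ∀ s : ℝ, 0 < s →
      (a 0) ^ 2 * (∫ r in (0:ℝ)..R, g r ^ m) - s * (∫ r in (0:ℝ)..R, deriv a r ^ 2 * g r ^ (m + 2))
        - (a 0) ^ 2 * (K / s) ≤ ∫ r in (0:ℝ)..R, a r ^ 2 * g r ^ m := by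
  set I := ∫ r in (0:ℝ)..R, g r ^ m with hI
  set G : ℝ → ℝ := fun r => ∫ x in (0:ℝ)..r, g x ^ m with hG
  have hgm : Continuous fun x => g x ^ m := hg.pow m
  have hGd : ∀ r, HasDerivAt G (g r ^ m) r := fun r => hgm.integral_hasStrictDerivAt 0 r |>.hasDerivAt
  have hGc : Continuous G := continuous_iff_continuousAt.2 fun r => (hGd r).continuousAt
  have hGac : AbsolutelyContinuousOnInterval G 0 R := by
    apply IntervalIntegrable.absolutelyContinuousOnInterval_intervalIntegral
    · exact hgm.intervalIntegrable _ _
    · simp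
  set Kc := (C0 ^ (2 * m) * R ^ m) / c0 ^ (m + 2) with hKc
  have hKc0 : 0 ≤ Kc := by positivity
  have hgnn : ∀ r ∈ Icc 0 R, 0 ≤ g r := fun r hr =>
    le_trans (mul_nonneg hc0.le (by linarith [hr.2])) (hlo r hr)
  have hH : ∀ r ∈ Icc 0 R, (I - G r) ^ 2 ≤ Kc * g r ^ (m + 2) := by
    intro r hr
    have hRr : 0 ≤ R - r := by linarith [hr.2]
    have e : I - G r = ∫ x in r..R, g x ^ m := by
      rw [hI, hG, intervalIntegral.integral_interval_sub_left] <;> exact hgm.intervalIntegrable _ _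
    have h0 : 0 ≤ I - G r := by
      rw [e]; apply intervalIntegral.integral_nonneg hr.2
      intro x hx; exact pow_nonneg (hgnn x ⟨hr.1.trans hx.1, hx.2⟩) _
    have h1 : I - G r ≤ (C0 * (R - r)) ^ m * (R - r) := by
      rw [e]
      have : ∫ x in r..R, g x ^ m ≤ ∫ x in r..R, (C0 * (R - r)) ^ m := by
        apply intervalIntegral.integral_mono_on hr.2 (hgm.intervalIntegrable _ _) (by simp)
        intro x hx
        have hx' : x ∈ Icc 0 R := ⟨hr.1.trans hx.1, hx.2⟩
        apply pow_le_pow_left₀ (hgnn x hx')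
        exact (hup x hx').trans (mul_le_mul_of_nonneg_left (by linarith [hx.1]) hC0.le)
      rw [intervalIntegral.integral_const, smul_eq_mul] at this
      linarith
    calc (I - G r) ^ 2 ≤ ((C0 * (R - r)) ^ m * (R - r)) ^ 2 := pow_le_pow_left₀ h0 h1 2
      _ = C0 ^ (2 * m) * (R - r) ^ m * (R - r) ^ (m + 2) := by
        generalize R - r = y
        ring
      _ ≤ C0 ^ (2 * m) * R ^ m * (R - r) ^ (m + 2) := by
        gcongr; linarith [hr.1]
      _ = Kc * (c0 * (R - r)) ^ (m + 2) := by
        rw [hKc, mul_pow]; field_simp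
      _ ≤ Kc * g r ^ (m + 2) := by
        gcongr; exact hlo r hr
  refine ⟨Kc * R, by positivity, ?_⟩
  rintro a ⟨⟨K, ha⟩, haR, -⟩ s hs
  have hac : AbsolutelyContinuousOnInterval a 0 R := by
    apply LipschitzOnWith.absolutelyContinuousOnInterval (K := K)
    rwa [uIcc_of_le hR.le]
  have hacont := a_continuousOn hR ha
  have hdi := hac.intervalIntegrable_deriv
  have i1 := hac.integral_deriv_eq_sub
  have i2 := hac.integral_mul_deriv_eq_deriv_mul hGac
  have hG0 : G 0 = 0 := by simp [hG]
  simp only [(hGd _).deriv, hG0, haR] at i1 i2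
  have i3 : ∫ r in (0:ℝ)..R, deriv a r * (I - G r) = (0 - a 0) * I - ∫ r in (0:ℝ)..R, deriv a r * G r := by
    rw [← i1, ← intervalIntegral.integral_mul_const, ← intervalIntegral.integral_sub]
    · congr 1; ext r; ring
    · exact hdi.mul_const _
    · exact hdi.mul_continuousOn hGc.continuousOn
  set A := ∫ r in (0:ℝ)..R, deriv a r ^ 2 * g r ^ (m + 2) with hA
  have iA := intA hR hg ha m
  have iB := intB hR hg ha m
  have iH : IntervalIntegrable (fun r => deriv a r * (I - G r)) volume 0 R :=
    hdi.mul_continuousOn (by fun_prop)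
  have iag : IntervalIntegrable (fun r => a r * g r ^ m) volume 0 R :=
    (hacont.mul hgm.continuousOn).intervalIntegrable
  have h1 : 0 ≤ s * A + 2 * a 0 * (∫ r in (0:ℝ)..R, deriv a r * (I - G r)) + R * ((a 0)^2 * Kc / s) := by
    have : 0 ≤ ∫ r in (0:ℝ)..R, (s * (deriv a r ^ 2 * g r ^ (m + 2)) +
        2 * a 0 * (deriv a r * (I - G r)) + (a 0)^2 * Kc / s) := by
      apply intervalIntegral.integral_nonneg hR.le
      intro r hr
      have hh := hH r hr
      have hw : 0 ≤ g r ^ (m + 2) := pow_nonneg (hgnn r hr) _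
      generalize g r ^ (m + 2) = w at *
      generalize I - G r = H at *
      generalize deriv a r = d at *
      rcases hw.eq_or_lt with rfl | hw
      · have : H = 0 := by nlinarith [sq_nonneg H]
        subst this; simp; positivity
      · have : s * (d ^ 2 * w) + 2 * a 0 * (d * H) + (a 0)^2 * Kc / s =
          ((s * w * d + a 0 * H) ^ 2 + (a 0)^2 * (Kc * w - H ^ 2)) / (s * w) := by
          field_simp; ring
        rw [this]
        have : 0 ≤ Kc * w - H ^ 2 := by linarith
        positivity
    rw [intervalIntegral.integral_add, intervalIntegral.integral_add,
      intervalIntegral.integral_const_mul, intervalIntegral.integral_const_mul,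
      intervalIntegral.integral_const, smul_eq_mul, sub_zero] at this
    · exact this
    · exact iA.const_mul _
    · exact iH.const_mul _
    · exact (iA.const_mul _).add (iH.const_mul _)
    · simp
  have h2 : 2 * a 0 * (∫ r in (0:ℝ)..R, a r * g r ^ m) - (a 0)^2 * I ≤
      ∫ r in (0:ℝ)..R, a r ^ 2 * g r ^ m := by
    rw [hI, ← intervalIntegral.integral_const_mul, ← intervalIntegral.integral_const_mul,
      ← intervalIntegral.integral_sub (iag.const_mul _) ((hgm.intervalIntegrable _ _).const_mul _)]
    apply intervalIntegral.integral_mono_on hR.le _ iB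
    · intro r hr
      have hw : 0 ≤ g r ^ m := pow_nonneg (hgnn r hr) _
      nlinarith [mul_nonneg hw (sq_nonneg (a r - a 0))]
    · exact (iag.const_mul _).sub ((hgm.intervalIntegrable _ _).const_mul _)
  have e3 : (a 0) ^ 2 * (Kc * R / s) = R * ((a 0)^2 * Kc / s) := by ring
  rw [i3] at h1
  rw [i2] at h2
  rw [e3]
  nlinarith [h1, h2]

lemma geom_bound (M : ℕ) {x : ℝ} (h0 : 0 ≤ x) (h1 : x ≤ 1) :
    (M + 1 : ℝ) * x ^ M * (1 - x) ≤ 1 := by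
  have h := geom_sum_mul_neg x (M + 1)
  have h2 : (M + 1 : ℝ) * x ^ M ≤ ∑ i ∈ Finset.range (M + 1), x ^ i := by
    have := Finset.card_nsmul_le_sum (Finset.range (M + 1)) (fun i => x ^ i) (x ^ M) (by
      intro i hi
      exact pow_le_pow_of_le_one h0 h1 (by have := Finset.mem_range.1 hi; omega))
    simpa using this
  have := mul_le_mul_of_nonneg_right h2 (by linarith : 0 ≤ 1 - x)
  have h3 : 0 ≤ x ^ (M + 1) := by positivity
  linarith

set_option maxHeartbeats 1000000 in
/-- A good test function. -/
lemma test_fn {R : ℝ} (hR : 0 < R) {g : ℝ → ℝ} (hg : Continuous g) {c0 C0 : ℝ}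
    (hc0 : 0 < c0) (hC0 : 0 < C0)
    (hlo : ∀ r ∈ Icc 0 R, c0 * (R - r) ≤ g r) (hup : ∀ r ∈ Icc 0 R, g r ≤ C0 * (R - r)) (m : ℕ)
    {lam : ℝ} (hlam : 0 < lam) :
    ∃ η : ℝ, 0 < η ∧ ∃ a : ℝ → ℝ, IsAdmissible R a ∧ a 0 = 1 ∧
      (∫ r in (0:ℝ)..R, deriv a r ^ 2 * g r ^ (m + 2)) + lam * (∫ r in (0:ℝ)..R, a r ^ 2 * g r ^ m)
        ≤ lam * (∫ r in (0:ℝ)..R, g r ^ m) - η := by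
  have hgm : Continuous fun x => g x ^ m := hg.pow m
  have hgnn : ∀ r ∈ Icc 0 R, 0 ≤ g r := fun r hr =>
    le_trans (mul_nonneg hc0.le (by linarith [hr.2])) (hlo r hr)
  set I := ∫ r in (0:ℝ)..R, g r ^ m with hI
  set I1 := ∫ r in (0:ℝ)..R, (r / R) * g r ^ m with hI1
  have hI1pos : 0 < I1 := by
    apply intervalIntegral.intervalIntegral_pos_of_pos_on _ _ hR
    · exact Continuous.intervalIntegrable (by fun_prop) _ _
    · intro x hx
      have : 0 < g x := lt_of_lt_of_le (mul_pos hc0 (by linarith [hx.2])) (hlo x ⟨hx.1.le, hx.2.le⟩)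
      have := hx.1
      positivity
  set P := (C0 * R) ^ (m + 2) with hP
  have hPpos : 0 < P := by positivity
  obtain ⟨t, ht0, ht1, ht2⟩ : ∃ t : ℝ, 0 < t ∧ t ≤ 1 ∧ t * (4 * P) ≤ lam * I1 * R := by
    refine ⟨min 1 (lam * I1 * R / (4 * P)), by positivity, min_le_left _ _, ?_⟩
    have := min_le_right 1 (lam * I1 * R / (4 * P))
    rwa [le_div_iff₀ (by positivity)] at this
  obtain ⟨M, hM⟩ : ∃ M : ℕ, 8 * P / (R * (lam * t * I1)) ≤ M := exists_nat_ge _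
  have hM' : 2 * P / (R * (M + 2)) ≤ lam * t * I1 / 4 := by
    rw [div_le_iff₀ (by positivity)] at hM
    rw [div_le_iff₀ (by positivity)]
    have : 0 < R * (lam * t * I1) := by positivity
    nlinarith
  have hgw : ∀ r ∈ Icc 0 R, g r ^ (m + 2) ≤ P * (1 - r / R) ^ 2 := by
    intro r hr
    have hx0 : 0 ≤ r / R := div_nonneg hr.1 hR.le
    have hx1 : r / R ≤ 1 := div_le_one_of_le₀ hr.2 hR.le
    have e : C0 * (R - r) = C0 * R * (1 - r / R) := by field_simp
    have h1 : g r ^ (m + 2) ≤ (C0 * R * (1 - r / R)) ^ (m + 2) := by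
      rw [← e]; exact pow_le_pow_left₀ (hgnn r hr) (hup r hr) _
    refine h1.trans ?_
    rw [mul_pow, hP]
    apply mul_le_mul_of_nonneg_left _ (by positivity)
    exact pow_le_pow_of_le_one (by linarith) (by linarith) (by omega)
  set a : ℝ → ℝ := fun r => 1 - t * (r / R) - (1 - t) * (r / R) ^ (M + 1) with ha
  have had : ∀ r, HasDerivAt a (-(t / R) - (1 - t) * ((M + 1 : ℝ) * (r / R) ^ M / R)) r := by
    intro r
    have hx : HasDerivAt (fun r : ℝ => r / R) (1 / R) r := (hasDerivAt_id r).div_const R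
    have := ((hx.const_mul t).const_sub 1).sub ((hx.pow (M + 1)).const_mul (1 - t))
    convert! this using 1
    push_cast
    simp
    ring
  have hader : deriv a = fun r => -(t / R) - (1 - t) * ((M + 1 : ℝ) * (r / R) ^ M / R) :=
    funext fun r => (had r).deriv
  have hac1 : ContDiff ℝ 1 a := by rw [ha]; fun_prop
  have hlip : ∃ K : NNReal, LipschitzOnWith K a (Icc 0 R) :=
    hac1.locallyLipschitz.locallyLipschitzOn.exists_lipschitzOnWith_of_compact isCompact_Icc
  refine ⟨lam * t * I1 / 4, by positivity, a, ⟨hlip, ?_, ?_⟩, ?_, ?_⟩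
  · simp [ha, hR.ne']
  · simp [ha]
  · simp [ha]
  obtain ⟨K, hK⟩ := hlip
  have hB : ∫ r in (0:ℝ)..R, a r ^ 2 * g r ^ m ≤ I - t * I1 := by
    rw [hI, hI1, ← intervalIntegral.integral_const_mul, ← intervalIntegral.integral_sub]
    · apply intervalIntegral.integral_mono_on hR.le (intB hR hg hK m)
        (Continuous.intervalIntegrable (by fun_prop) _ _)
      intro r hr
      have hx0 : 0 ≤ r / R := div_nonneg hr.1 hR.le
      have hx1 : r / R ≤ 1 := div_le_one_of_le₀ hr.2 hR.le
      have hw : 0 ≤ g r ^ m := pow_nonneg (hgnn r hr) _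
      have hxN : (r / R) ^ (M + 1) ≤ r / R := pow_le_of_le_one hx0 hx1 (by omega)
      have hxN0 : 0 ≤ (r / R) ^ (M + 1) := by positivity
      have b1 : 0 ≤ a r := by
        simp only [ha]; nlinarith
      have b2 : a r ≤ 1 - t * (r / R) := by
        simp only [ha]; nlinarith
      have b3 : 0 ≤ t * (r / R) := by positivity
      have : a r ^ 2 ≤ 1 - t * (r / R) := by nlinarith
      nlinarith [mul_le_mul_of_nonneg_right this hw]
    · exact hgm.intervalIntegrable _ _
    · exact Continuous.intervalIntegrable (by fun_prop) _ _
  have hA : ∫ r in (0:ℝ)..R, deriv a r ^ 2 * g r ^ (m + 2) ≤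
      2 * t ^ 2 * P / R + 2 * P / (R * (M + 2)) := by
    have hF : ∫ r in (0:ℝ)..R, (2 * t ^ 2 * P / R ^ 2 +
        2 * P / R ^ 2 * ((M + 1 : ℝ) * (r / R) ^ M * (1 - r / R))) =
        2 * t ^ 2 * P / R + 2 * P / (R * (M + 2)) := by
      have hd : ∀ r ∈ uIcc 0 R, HasDerivAt (fun r : ℝ => 2 * t ^ 2 * P / R ^ 2 * r + 2 * P / R ^ 2 *
          (R * ((r / R) ^ (M + 1) - (M + 1 : ℝ) / (M + 2) * (r / R) ^ (M + 2))))
          (2 * t ^ 2 * P / R ^ 2 + 2 * P / R ^ 2 * ((M + 1 : ℝ) * (r / R) ^ M * (1 - r / R))) r := by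
        intro r _
        have hx : HasDerivAt (fun r : ℝ => r / R) (1 / R) r := (hasDerivAt_id r).div_const R
        have := ((hasDerivAt_id r).const_mul (2 * t ^ 2 * P / R ^ 2)).add
          ((((hx.pow (M + 1)).sub ((hx.pow (M + 2)).const_mul ((M + 1 : ℝ) / (M + 2)))).const_mul
            R).const_mul (2 * P / R ^ 2))
        convert! this using 1
        have h2 : (M + 2 : ℝ) ≠ 0 := by positivity
        push_cast
        try simp only [Nat.add_sub_cancel, show M + 2 - 1 = M + 1 by omega]
        generalize hy : r / R = y
        field_simp
        ring
      rw [intervalIntegral.integral_eq_sub_of_hasDerivAt hd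
        (Continuous.intervalIntegrable (by fun_prop) _ _)]
      have h2 : (M + 2 : ℝ) ≠ 0 := by positivity
      rw [div_self hR.ne']
      simp
      field_simp
      ring
    rw [← hF]
    apply intervalIntegral.integral_mono_on hR.le (intA hR hg hK m)
        (Continuous.intervalIntegrable (by fun_prop) _ _)
    intro r hr
    have hx0 : 0 ≤ r / R := div_nonneg hr.1 hR.le
    have hx1 : r / R ≤ 1 := div_le_one_of_le₀ hr.2 hR.le
    rw [(had r).deriv]
    refine (mul_le_mul_of_nonneg_left (hgw r hr) (sq_nonneg _)).trans ?_
    have gb := geom_bound M hx0 hx1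
    generalize r / R = x at *
    have gb0 : 0 ≤ (M + 1 : ℝ) * x ^ M * (1 - x) := mul_nonneg (by positivity) (by linarith)
    have e : (-(t / R) - (1 - t) * ((M + 1 : ℝ) * x ^ M / R)) ^ 2 * (P * (1 - x) ^ 2) =
      P / R ^ 2 * (t * (1 - x) + (1 - t) * ((M + 1 : ℝ) * x ^ M * (1 - x))) ^ 2 := by
      field_simp; ring
    have e2 : 2 * t ^ 2 * P / R ^ 2 + 2 * P / R ^ 2 * ((M + 1 : ℝ) * x ^ M * (1 - x)) =
      P / R ^ 2 * (2 * t ^ 2 + 2 * ((M + 1 : ℝ) * x ^ M * (1 - x))) := by ring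
    simp only [e, e2]
    apply mul_le_mul_of_nonneg_left _ (by positivity)
    generalize (M + 1 : ℝ) * x ^ M * (1 - x) = q at *
    have c1 : (t * (1 - x)) ^ 2 ≤ t ^ 2 :=
      pow_le_pow_left₀ (mul_nonneg ht0.le (by linarith)) (by nlinarith) 2
    have c2 : ((1 - t) * q) ^ 2 ≤ q := by
      have : (1 - t) * q ≤ q := by nlinarith
      have h0 : 0 ≤ (1 - t) * q := mul_nonneg (by linarith) gb0
      generalize (1 - t) * q = z at *
      nlinarith
    generalize t * (1 - x) = u at *
    generalize (1 - t) * q = z at *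
    nlinarith [sq_nonneg (u - z)]
  have h3 : 2 * t ^ 2 * P / R ≤ lam * t * I1 / 2 := by
    rw [div_le_iff₀ hR]
    nlinarith
  nlinarith

/-- Two-sided linear bounds and a continuous extension of `h`. -/
lemma exists_ext {R : ℝ} (hR : 0 < R) {h : ℝ → ℝ} (hH : SatisfiesH R h) :
    ∃ g : ℝ → ℝ, Continuous g ∧ (∀ r ∈ Icc 0 R, g r = h r) ∧ ∃ c0 C0 : ℝ, 0 < c0 ∧ 0 < C0 ∧
      (∀ r ∈ Icc 0 R, c0 * (R - r) ≤ g r) ∧ (∀ r ∈ Icc 0 R, g r ≤ C0 * (R - r)) := by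
  obtain ⟨hs, hpos, hhR, hd, -⟩ := hH
  have hcont := hs.continuousOn
  have hmem : R ∈ Icc 0 R := ⟨hR.le, le_rfl⟩
  have hder : HasDerivWithinAt h (-1) (Icc 0 R) R := by
    rw [← hd]
    exact ((hs.differentiableOn (by simp)) R hmem).hasDerivWithinAt
  set q : ℝ → ℝ := Function.update (fun r => h r / (R - r)) R 1 with hq
  have hqc : ContinuousOn q (Icc 0 R) := by
    intro r hr
    rcases eq_or_ne r R with rfl | hne
    · rw [hq, continuousWithinAt_update_same]
      have := (hasDerivWithinAt_iff_tendsto_slope.1 hder).neg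
      rw [neg_neg] at this
      refine this.congr fun x => ?_
      rw [slope_def_field, hhR, sub_zero, ← div_neg, neg_sub]
    · rw [hq, continuousWithinAt_update_of_ne hne]
      exact (hcont r hr).div (by fun_prop) (sub_ne_zero.2 hne.symm)
  have hqpos : ∀ r ∈ Icc 0 R, 0 < q r := by
    intro r hr
    rcases eq_or_ne r R with rfl | hne
    · simp [hq]
    · rw [hq, Function.update_of_ne hne]
      have : r < R := lt_of_le_of_ne hr.2 hne
      exact div_pos (hpos r ⟨hr.1, this⟩) (by linarith)
  have hqe : ∀ r ∈ Icc 0 R, h r = q r * (R - r) := by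
    intro r hr
    rcases eq_or_ne r R with rfl | hne
    · simp [hhR]
    · rw [hq, Function.update_of_ne hne, div_mul_cancel₀ _ (sub_ne_zero.2 hne.symm)]
  obtain ⟨x, hx, hxm⟩ := isCompact_Icc.exists_isMinOn ⟨R, hmem⟩ hqc
  obtain ⟨y, hy, hym⟩ := isCompact_Icc.exists_isMaxOn ⟨R, hmem⟩ hqc
  have hge : ∀ r ∈ Icc 0 R, IccExtend hR.le ((Icc 0 R).domRestrict h) r = h r := fun r hr => by
    rw [IccExtend_of_mem _ _ hr]; rfl
  refine ⟨IccExtend hR.le ((Icc 0 R).domRestrict h), ?_, hge, q x, q y, hqpos x hx, hqpos y hy, ?_, ?_⟩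
  · exact (continuousOn_iff_continuous_domRestrict.1 hcont).Icc_extend'
  · intro r hr
    rw [hge r hr, hqe r hr]
    exact mul_le_mul_of_nonneg_right (hxm hr) (by linarith [hr.2])
  · intro r hr
    rw [hge r hr, hqe r hr]
    exact mul_le_mul_of_nonneg_right (hym hr) (by linarith [hr.2])

lemma rayleigh_eq {R : ℝ} (hR : 0 < R) {h g : ℝ → ℝ} (hg : Continuous g)
    (hgh : ∀ r ∈ Icc 0 R, g r = h r) (m : ℕ) (lam : ℝ) {a : ℝ → ℝ} (ha : IsAdmissible R a) :
    rayleighQ R (m + 3) lam h a =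
      ((∫ r in (0:ℝ)..R, deriv a r ^ 2 * g r ^ (m + 2)) +
        lam * (∫ r in (0:ℝ)..R, a r ^ 2 * g r ^ m)) / ((a 0) ^ 2 * g 0 ^ (m + 2)) := by
  obtain ⟨⟨K, hK⟩, -, -⟩ := ha
  have e1 : (((m + 3 : ℕ) : ℤ) - 1) = ((m + 2 : ℕ) : ℤ) := by push_cast; ring
  have e2 : (((m + 3 : ℕ) : ℤ) - 3) = ((m : ℕ) : ℤ) := by push_cast; ring
  unfold rayleighQ
  rw [e1, e2, hgh 0 ⟨le_rfl, hR.le⟩, zpow_natCast, ← intervalIntegral.integral_const_mul,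
    ← intervalIntegral.integral_add (intA hR hg hK m) ((intB hR hg hK m).const_mul _)]
  congr 1
  apply intervalIntegral.integral_congr
  intro r hr
  rw [uIcc_of_le hR.le] at hr
  simp only [zpow_natCast, hgh r hr]
  ring

lemma main_strict {R : ℝ} (hR : 0 < R) {h : ℝ → ℝ} (hH : SatisfiesH R h) (m k l : ℕ)
    (hlam : 0 < sphereEig (m + 3) k) (hmu : sphereEig (m + 3) k < sphereEig (m + 3) l) :
    0 ≤ steklov R (m + 3) l h ∧ steklov R (m + 3) l h * sphereEig (m + 3) k <
      sphereEig (m + 3) l * steklov R (m + 3) k h := by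
  obtain ⟨g, hg, hgh, c0, C0, hc0, hC0, hlo, hup⟩ := exists_ext hR hH
  unfold steklov
  generalize sphereEig (m + 3) k = lam at *
  generalize sphereEig (m + 3) l = mu at *
  obtain ⟨K, hK0, hKb⟩ := lower_bound hR hg hc0 hC0 hlo hup m
  obtain ⟨η, hη, a₀, ha₀, ha₀1, ha₀E⟩ := test_fn hR hg hc0 hC0 hlo hup m hlam
  have hgnn : ∀ r ∈ Icc 0 R, 0 ≤ g r := fun r hr =>
    le_trans (mul_nonneg hc0.le (by linarith [hr.2])) (hlo r hr)
  have hg0 : 0 < g 0 := lt_of_lt_of_le (by rw [sub_zero]; positivity) (hlo 0 ⟨le_rfl, hR.le⟩)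
  have hw0 : 0 < g 0 ^ (m + 2) := by positivity
  set w0 := g 0 ^ (m + 2) with hw0d
  set I := ∫ r in (0:ℝ)..R, g r ^ m
  have hAnn : ∀ a : ℝ → ℝ, 0 ≤ ∫ r in (0:ℝ)..R, deriv a r ^ 2 * g r ^ (m + 2) := fun a =>
    intervalIntegral.integral_nonneg hR.le fun r hr =>
      mul_nonneg (sq_nonneg _) (pow_nonneg (hgnn r hr) _)
  have hBnn : ∀ a : ℝ → ℝ, 0 ≤ ∫ r in (0:ℝ)..R, a r ^ 2 * g r ^ m := fun a =>
    intervalIntegral.integral_nonneg hR.le fun r hr =>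
      mul_nonneg (sq_nonneg _) (pow_nonneg (hgnn r hr) _)
  have hnn : ∀ ν : ℝ, 0 < ν → ∀ v ∈ {v : ℝ | ∃ a : ℝ → ℝ, IsAdmissible R a ∧
      v = rayleighQ R (m + 3) ν h a}, 0 ≤ v := by
    rintro ν hν v ⟨a, ha, rfl⟩
    rw [rayleigh_eq hR hg hgh m ν ha]
    have := hAnn a
    have := hBnn a
    positivity
  have hmu0 : 0 < mu := hlam.trans hmu
  refine ⟨Real.sInf_nonneg (hnn mu hmu0), ?_⟩
  set Sl := {v : ℝ | ∃ a : ℝ → ℝ, IsAdmissible R a ∧ v = rayleighQ R (m + 3) lam h a} with hSl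
  set Sm := {v : ℝ | ∃ a : ℝ → ℝ, IsAdmissible R a ∧ v = rayleighQ R (m + 3) mu h a} with hSm
  have hbl : BddBelow Sl := ⟨0, fun v hv => hnn lam hlam v hv⟩
  have hbm : BddBelow Sm := ⟨0, fun v hv => hnn mu hmu0 v hv⟩
  have hne : Sl.Nonempty := ⟨_, a₀, ha₀, rfl⟩
  have hF : sInf Sl * w0 ≤ lam * I - η := by
    have := csInf_le hbl ⟨a₀, ha₀, rfl⟩
    rw [rayleigh_eq hR hg hgh m lam ha₀, ha₀1, one_pow, one_mul, le_div_iff₀ hw0] at this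
    linarith
  set s := 4 * lam * (K + 1) / η with hs
  have hs0 : 0 < s := by positivity
  set c := η / (4 * lam * s) with hc
  have hc0' : 0 < c := by positivity
  set ε := min (η / 4) ((mu - lam) * c / (2 * mu)) with hε
  have hml : 0 < mu - lam := by linarith
  have hε0 : 0 < ε := by positivity
  obtain ⟨v, ⟨a, ha, rfl⟩, hv⟩ := exists_lt_of_csInf_lt hne
    (show sInf Sl < sInf Sl + ε / w0 by have : 0 < ε / w0 := by positivity
                                        linarith)
  have hm := csInf_le hbm ⟨a, ha, rfl⟩
  have hb := hKb a ha s hs0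
  have hcc : 0 < (a 0) ^ 2 := by have := ha.2.2; positivity
  rw [rayleigh_eq hR hg hgh m _ ha] at hv hm
  rw [← hw0d] at hv hm
  have hA := hAnn a
  generalize (∫ r in (0:ℝ)..R, deriv a r ^ 2 * g r ^ (m + 2)) = A at *
  generalize (∫ r in (0:ℝ)..R, a r ^ 2 * g r ^ m) = B at *
  generalize (a 0) ^ 2 = D at *
  generalize sInf Sl = F at *
  generalize sInf Sm = F' at *
  obtain ⟨α, rfl⟩ : ∃ α, A = D * α := ⟨A / D, by field_simp⟩
  obtain ⟨β, rfl⟩ : ∃ β, B = D * β := ⟨B / D, by field_simp⟩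
  have e1 : ∀ ν : ℝ, (D * α + ν * (D * β)) / (D * w0) = (α + ν * β) / w0 := fun ν => by
    field_simp
  rw [e1] at hv hm
  have hv' : α + lam * β < F * w0 + ε := by
    rw [div_lt_iff₀ hw0] at hv
    have : (F + ε / w0) * w0 = F * w0 + ε := by field_simp
    linarith
  rw [le_div_iff₀ hw0] at hm
  have hb' : I - s * α - K / s ≤ β := by
    have : D * (I - s * α - K / s) ≤ D * β := by linarith
    exact le_of_mul_le_mul_left this hcc
  have hα0 : 0 ≤ α := nonneg_of_mul_nonneg_right hA hcc
  have hε1 : ε ≤ η / 4 := min_le_left _ _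
  have hε2 : mu * ε < (mu - lam) * c := by
    have : ε ≤ (mu - lam) * c / (2 * mu) := min_le_right _ _
    rw [le_div_iff₀ (by positivity)] at this
    have : 0 < mu * ε := by positivity
    nlinarith
  have k1 : lam * (K / s) ≤ η / 4 := by
    have : lam * (K / s) = η / 4 * (K / (K + 1)) := by rw [hs]; field_simp
    rw [this]
    have : K / (K + 1) ≤ 1 := by rw [div_le_one (by positivity)]; linarith
    nlinarith
  have k2 : lam * s * c = η / 4 := by rw [hc]; field_simp
  have hαc : c ≤ α := by
    by_contra hlt
    push Not at hlt
    have : lam * s * α < lam * s * c := mul_lt_mul_of_pos_left hlt (by positivity)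
    have := mul_le_mul_of_nonneg_left hb' hlam.le
    nlinarith
  have fin : F' * lam * w0 < mu * F * w0 := by
    have q1 := mul_le_mul_of_nonneg_right hm hlam.le
    have q2 := mul_lt_mul_of_pos_left hv' hmu0
    have q3 := mul_le_mul_of_nonneg_left hαc hml.le
    nlinarith
  exact lt_of_mul_lt_mul_right fin hw0.le

end SteklovAux

theorem stmt_0 (n : ℕ) (hn : 3 ≤ n) (R : ℝ) (hR : 0 < R) (h : ℝ → ℝ)
    (hH : SatisfiesH R h) (k : ℕ) (hk : 1 ≤ k) :
    steklov R n (k + 1) h / steklov R n k h < sphereEig n (k + 1) / sphereEig n k ∧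
    sphereEig n (k + 1) / sphereEig n k =
      (((k : ℝ) + 1) * ((n : ℝ) + (k : ℝ) - 1)) / ((k : ℝ) * ((n : ℝ) + (k : ℝ) - 2)) := by
  have hk' : (1 : ℝ) ≤ k := by exact_mod_cast hk
  have hn' : (3 : ℝ) ≤ n := by exact_mod_cast hn
  have hlam : 0 < sphereEig n k := by
    unfold sphereEig
    apply mul_pos <;> linarith
  have hmu : sphereEig n k < sphereEig n (k + 1) := by
    unfold sphereEig
    push_cast
    nlinarith
  constructor
  · obtain ⟨m, rfl⟩ : ∃ m, n = m + 3 := ⟨n - 3, by omega⟩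
    obtain ⟨h1, h2⟩ := SteklovAux.main_strict hR hH m k (k + 1) hlam hmu
    have h3 : 0 < steklov R (m + 3) k h := by
      have : 0 < sphereEig (m + 3) (k + 1) * steklov R (m + 3) k h :=
        lt_of_le_of_lt (mul_nonneg h1 hlam.le) h2
      exact pos_of_mul_pos_right this (hlam.trans hmu).le
    rw [div_lt_div_iff₀ h3 hlam]
    exact h2
  · unfold sphereEig
    push_cast
    congr 1
    ring
end

section
/- Let n = 2, let h satisfy hypotheses (H), and let k ≥ 1 be an integer. Then σ_(k)(g_h) = k/h(0); equivalently, the infimum over all Lipschitz functions a : [0,R] → ℝ with a(R) = 0 and a(0) ≠ 0 of (∫₀^R ((a'(r))² h(r) + k² a(r)²/h(r)) dr)/(a(0)² h(0)) equals k/h(0). -/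
open MeasureTheory Set

/-- `h` is bounded below by a positive multiple of the distance to `R`. -/
lemma h_lower {R : ℝ} (hR : 0 < R) {h : ℝ → ℝ} (hH : SatisfiesH R h) :
    ∃ c > 0, ∀ r ∈ Icc (0:ℝ) R, c * (R - r) ≤ h r := by
  obtain ⟨hs, hp, h0, hd, -⟩ := hH
  have hRm : R ∈ Icc (0:ℝ) R := ⟨hR.le, le_rfl⟩
  have hD : HasDerivWithinAt h (-1) (Icc 0 R) R := by
    rw [← hd]
    exact ((hs.differentiableOn (by simp)) R hRm).hasDerivWithinAt
  have hc : ContinuousOn (Function.update (slope h R) R (-1)) (Icc 0 R) := by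
    intro x hx
    by_cases hxR : x = R
    · subst hxR
      rw [continuousWithinAt_update_same]
      exact hasDerivWithinAt_iff_tendsto_slope.1 hD
    · rw [continuousWithinAt_update_of_ne hxR]
      have h1 : ContinuousWithinAt (fun y => (y - R)⁻¹ * (h y - h R)) (Icc 0 R) x := by
        apply ContinuousWithinAt.mul
        · apply ContinuousWithinAt.inv₀ (by fun_prop)
          exact sub_ne_zero.2 hxR
        · exact (hs.continuousOn x hx).sub continuousWithinAt_const
      exact h1
  obtain ⟨x, hx, hmax⟩ := isCompact_Icc.exists_isMaxOn ⟨R, hRm⟩ hc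
  have hneg : Function.update (slope h R) R (-1) x < 0 := by
    by_cases hxR : x = R
    · subst hxR; simp
    · have hlt : x < R := lt_of_le_of_ne hx.2 hxR
      rw [Function.update_of_ne hxR, slope_def_field, h0]
      exact div_neg_of_pos_of_neg (by simpa using hp x ⟨hx.1, hlt⟩) (by linarith)
  refine ⟨-Function.update (slope h R) R (-1) x, by linarith, ?_⟩
  intro r hr
  by_cases hrR : r = R
  · subst hrR; simp [h0]
  · have hlt : r < R := lt_of_le_of_ne hr.2 hrR
    have := hmax hr
    simp only [mem_setOf_eq] at this
    rw [Function.update_of_ne hrR, slope_def_field, h0] at this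
    generalize Function.update (slope h R) R (-1) x = m at this
    rw [div_le_iff_of_neg (by linarith)] at this
    linarith

lemma key_int {R : ℝ} (hR : 0 < R) {a : ℝ → ℝ} (ha : IsAdmissible R a) (k : ℝ) :
    IntervalIntegrable (fun r => -2 * k * (a r * deriv a r)) volume 0 R ∧
    ∫ r in (0:ℝ)..R, -2 * k * (a r * deriv a r) = k * a 0 ^ 2 := by
  obtain ⟨⟨K, hK⟩, haR, ha0⟩ := ha
  rw [← uIcc_of_le hR.le] at hK
  have hac := hK.absolutelyContinuousOnInterval
  have h2 := hac.integral_deriv_mul_eq_sub hac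
  refine ⟨(hac.intervalIntegrable_deriv.continuousOn_mul hac.continuousOn).const_mul _, ?_⟩
  rw [show (fun x => deriv a x * a x + a x * deriv a x) = fun x => 2 * (a x * deriv a x) by
    funext x; ring, intervalIntegral.integral_const_mul, haR] at h2
  rw [intervalIntegral.integral_const_mul]
  linear_combination -k * h2

lemma energy_integrable {R : ℝ} (hR : 0 < R) {h : ℝ → ℝ} (hH : SatisfiesH R h) {a : ℝ → ℝ}
    (ha : IsAdmissible R a) (k : ℝ) :
    IntervalIntegrable (fun r => (deriv a r) ^ 2 * h r + k ^ 2 * (a r) ^ 2 / h r) volume 0 R := by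
  obtain ⟨c, hc, hlow⟩ := h_lower hR hH
  obtain ⟨hs, hp, h0, hd, -⟩ := hH
  obtain ⟨⟨K, hK⟩, haR, ha0⟩ := ha
  rw [intervalIntegrable_iff_integrableOn_Ioo_of_le hR.le]
  obtain ⟨M, hM⟩ := isCompact_Icc.exists_bound_of_continuousOn hs.continuousOn
  have hhm : AEMeasurable h (volume.restrict (Ioo 0 R)) :=
    (hs.continuousOn.mono Ioo_subset_Icc_self).aemeasurable measurableSet_Ioo
  have ham : AEMeasurable a (volume.restrict (Ioo 0 R)) :=
    (hK.continuousOn.mono Ioo_subset_Icc_self).aemeasurable measurableSet_Ioo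
  refine Integrable.of_bound (C := K ^ 2 * M + k ^ 2 * (K ^ 2 * R / c)) ?_ ?_
  · apply AEMeasurable.aestronglyMeasurable
    exact (((measurable_deriv a).aemeasurable.pow_const 2).mul hhm).add
      (((ham.pow_const 2).const_mul _).div hhm)
  · filter_upwards [ae_restrict_mem measurableSet_Ioo] with r hr
    have hr' := Ioo_subset_Icc_self hr
    have hpos := hp r ⟨hr.1.le, hr.2⟩
    have hdle := norm_deriv_le_of_lipschitzOn (Icc_mem_nhds hr.1 hr.2) hK
    have hMr := hM r hr'
    rw [Real.norm_eq_abs] at hdle hMr ⊢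
    rw [abs_of_pos hpos] at hMr
    have hal := hK.dist_le_mul r hr' R ⟨hR.le, le_rfl⟩
    rw [haR, Real.dist_eq, Real.dist_eq, sub_zero, abs_sub_comm r R,
      abs_of_pos (sub_pos.2 hr.2)] at hal
    have e1 : (deriv a r) ^ 2 ≤ (K:ℝ) ^ 2 := by
      rw [← sq_abs]; gcongr
    have e2 : (a r) ^ 2 ≤ (K * (R - r)) ^ 2 := by
      rw [← sq_abs]; gcongr
    have e3 : (a r) ^ 2 / h r ≤ K ^ 2 * R / c := by
      rw [div_le_div_iff₀ hpos hc]
      have hRr := sub_pos.2 hr.2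
      calc a r ^ 2 * c ≤ (K * (R - r)) ^ 2 * c := by gcongr
        _ = K ^ 2 * (R - r) * (c * (R - r)) := by ring
        _ ≤ K ^ 2 * R * h r := by
          have := hlow r hr'
          have h3 : R - r ≤ R := by linarith [hr.1]
          gcongr
    rw [abs_of_nonneg (by positivity), mul_div_assoc]
    gcongr

lemma lower_bd {R : ℝ} (hR : 0 < R) {h : ℝ → ℝ} (hH : SatisfiesH R h) {a : ℝ → ℝ}
    (ha : IsAdmissible R a) (k : ℝ) :
    k * a 0 ^ 2 ≤ ∫ r in (0:ℝ)..R, (deriv a r) ^ 2 * h r + k ^ 2 * (a r) ^ 2 / h r := by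
  obtain ⟨h1, h2⟩ := key_int hR ha k
  rw [← h2]
  apply intervalIntegral.integral_mono_on_of_le_Ioo hR.le h1 (energy_integrable hR hH ha k)
  intro r hr
  have hpos := hH.2.1 r ⟨hr.1.le, hr.2⟩
  have : (deriv a r) ^ 2 * h r + k ^ 2 * (a r) ^ 2 / h r - (-2 * k * (a r * deriv a r))
      = (deriv a r * h r + k * a r) ^ 2 / h r := by
    field_simp
    ring
  have h3 : 0 ≤ (deriv a r * h r + k * a r) ^ 2 / h r := by positivity
  linarith

/-- The derivative of `h` is close to `-1` relative to `h`. -/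
lemma deriv_bd {R : ℝ} (hR : 0 < R) {h : ℝ → ℝ} (hH : SatisfiesH R h) :
    ∃ C : ℝ, ∀ r ∈ Ioo (0:ℝ) R, -(1 + deriv h r) ≤ C * h r := by
  obtain ⟨c, hc, hlow⟩ := h_lower hR hH
  obtain ⟨hs, hp, h0, hd, -⟩ := hH
  have h1 : ContDiffOn ℝ 1 (derivWithin h (Icc 0 R)) (Icc 0 R) :=
    hs.derivWithin (uniqueDiffOn_Icc hR) (by
      rw [one_add_one_eq_two]
      exact WithTop.coe_le_coe.2 (le_top : (2 : ℕ∞) ≤ ⊤))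
  obtain ⟨K, hK⟩ := h1.exists_lipschitzOnWith (by simp) (convex_Icc _ _) isCompact_Icc
  refine ⟨K / c, fun r hr => ?_⟩
  have hr' := Ioo_subset_Icc_self hr
  have h2 := hK.dist_le_mul r hr' R ⟨hR.le, le_rfl⟩
  rw [derivWithin_of_mem_nhds (Icc_mem_nhds hr.1 hr.2), hd, Real.dist_eq, Real.dist_eq,
    abs_sub_comm r R, abs_of_pos (sub_pos.2 hr.2)] at h2
  have h3 := neg_abs_le (deriv h r - -1)
  have h4 := hlow r hr'
  have h5 : (K:ℝ) * (R - r) ≤ K / c * h r := by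
    calc (K:ℝ) * (R - r) = K / c * (c * (R - r)) := by field_simp
      _ ≤ K / c * h r := by gcongr
  linarith

lemma exists_min {R : ℝ} (hR : 0 < R) {h : ℝ → ℝ} (hH : SatisfiesH R h) {k : ℝ} (hk : 1 ≤ k) :
    ∃ a : ℝ → ℝ, IsAdmissible R a ∧ a 0 = 1 ∧
      ∀ r ∈ Ioo (0:ℝ) R, deriv a r = -k * a r / h r := by
  obtain ⟨C, hC⟩ := deriv_bd hR hH
  obtain ⟨hs, hp, h0, hd, -⟩ := hH
  set H : ℝ → ℝ := IccExtend hR.le ((Icc 0 R).restrict h) with hHdef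
  have Hc : Continuous H := hs.continuousOn.restrict.Icc_extend'
  have Heq : ∀ r ∈ Icc (0:ℝ) R, H r = h r := fun r hr => by
    rw [hHdef, IccExtend_of_mem hR.le _ hr]; rfl
  have Hpos : ∀ r < R, 0 < H r := fun r hr => by
    rcases le_total 0 r with h1 | h1
    · rw [Heq r ⟨h1, hr.le⟩]; exact hp r ⟨h1, hr⟩
    · rw [hHdef, IccExtend_of_le_left _ _ h1]; exact hp 0 ⟨le_rfl, hR⟩
  set F : ℝ → ℝ := fun r => ∫ x in (0:ℝ)..r, (H x)⁻¹ with hF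
  have Fd : ∀ r < R, HasDerivAt F (H r)⁻¹ r := fun r hr => by
    apply intervalIntegral.integral_hasDerivAt_right
    · apply ContinuousOn.intervalIntegrable
      apply Hc.continuousOn.inv₀
      intro x hx
      have : x ≤ max 0 r := hx.2
      exact (Hpos x (this.trans_lt (max_lt hR hr))).ne'
    · exact Hc.measurable.inv.stronglyMeasurable.stronglyMeasurableAtFilter
    · exact Hc.continuousAt.inv₀ (Hpos r hr).ne'
  set E : ℝ → ℝ := fun r => Real.exp (-k * F r) with hE
  have Ed : ∀ r < R, HasDerivAt E (-k * E r / H r) r := fun r hr => by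
    have := ((Fd r hr).const_mul (-k)).exp
    convert this using 1
    simp only [hE]
    ring
  have E0 : E 0 = 1 := by simp [hE, hF]
  have Epos : ∀ r, 0 < E r := fun r => Real.exp_pos _
  -- the quotient bound
  have hanti : AntitoneOn (fun r => Real.exp (-C * r) * (E r / H r)) (Ico 0 R) := by
    have hder : ∀ r ∈ Ioo (0:ℝ) R, HasDerivAt (fun r => Real.exp (-C * r) * (E r / H r))
        (Real.exp (-C * r) * (-C) * (E r / H r) +
          Real.exp (-C * r) * ((-k * E r / H r * H r - E r * deriv h r) / H r ^ 2)) r := by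
      intro r hr
      have hHd : HasDerivAt H (deriv h r) r := by
        have h1 : HasDerivAt h (deriv h r) r :=
          ((hs.differentiableOn (by simp)).differentiableAt
            (Icc_mem_nhds hr.1 hr.2)).hasDerivAt
        apply h1.congr_of_eventuallyEq
        filter_upwards [Icc_mem_nhds hr.1 hr.2] with x hx using Heq x hx
      have h2 : HasDerivAt (fun r => Real.exp (-C * r)) (Real.exp (-C * r) * (-C)) r := by
        simpa using ((hasDerivAt_id r).const_mul (-C)).exp
      exact h2.mul ((Ed r hr.2).div hHd (Hpos r hr.2).ne')
    apply antitoneOn_of_deriv_nonpos (convex_Ico _ _)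
    · intro r hr
      apply ContinuousAt.continuousWithinAt
      apply ContinuousAt.mul (by fun_prop)
      exact (Ed r hr.2).continuousAt.div Hc.continuousAt (Hpos r hr.2).ne'
    · rw [interior_Ico]
      exact fun r hr => (hder r hr).differentiableAt.differentiableWithinAt
    · rw [interior_Ico]
      intro r hr
      rw [(hder r hr).deriv]
      have hpos := Hpos r hr.2
      have e := hC r hr
      rw [← Heq r (Ioo_subset_Icc_self hr)] at e
      have : Real.exp (-C * r) * (-C) * (E r / H r) +
          Real.exp (-C * r) * ((-k * E r / H r * H r - E r * deriv h r) / H r ^ 2)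
          = Real.exp (-C * r) * E r / H r ^ 2 * (-(k + deriv h r) - C * H r) := by
        field_simp
        ring
      rw [this]
      apply mul_nonpos_of_nonneg_of_nonpos
      · have := Epos r
        positivity
      · linarith
  obtain ⟨M, hM0, hM⟩ : ∃ M : ℝ, 0 ≤ M ∧ ∀ r ∈ Ico (0:ℝ) R, E r ≤ M * H r := by
    refine ⟨Real.exp (|C| * R) * (E 0 / H 0), ?_, fun r hr => ?_⟩
    · have := Epos 0
      have := Hpos 0 hR
      positivity
    · have h1 := hanti ⟨le_rfl, hR⟩ hr hr.1
      simp only [mul_zero, Real.exp_zero, one_mul] at h1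
      have hpos := Hpos r hr.2
      have h2 : E r / H r = Real.exp (C * r) * (Real.exp (-C * r) * (E r / H r)) := by
        rw [← mul_assoc, ← Real.exp_add]; simp
      have h3 : C * r ≤ |C| * R := by
        calc C * r ≤ |C| * r := by gcongr; exact hr.1; exact le_abs_self C
          _ ≤ |C| * R := by have := hr.2.le; gcongr
      rw [← div_le_iff₀ hpos, h2]
      have := Epos 0
      have := Hpos 0 hR
      gcongr
  set a : ℝ → ℝ := fun r => if r < R then E r else 0 with ha
  have aE : ∀ r < R, a r = E r := fun r hr => by simp [ha, hr]
  have aR : a R = 0 := by simp [ha]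
  have ad : ∀ r < R, HasDerivAt a (-k * E r / H r) r := fun r hr => by
    apply (Ed r hr).congr_of_eventuallyEq
    filter_upwards [Iio_mem_nhds hr] with x hx using aE x hx
  have alip : LipschitzOnWith (k * M).toNNReal a (Ico 0 R) := by
    apply (convex_Ico 0 R).lipschitzOnWith_of_nnnorm_hasDerivWithin_le
      (fun r hr => (ad r hr.2).hasDerivWithinAt)
    intro r hr
    rw [← NNReal.coe_le_coe, coe_nnnorm, Real.coe_toNNReal _ (by positivity), Real.norm_eq_abs]
    have hpos := Hpos r hr.2
    have := Epos r
    rw [abs_div, abs_mul, abs_neg, abs_of_pos hpos, abs_of_pos this, abs_of_pos (by linarith : 0 < k),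
      div_le_iff₀ hpos, mul_assoc]
    have := hM r hr
    gcongr
  have acont : ContinuousOn a (closure (Ico 0 R)) := by
    rw [closure_Ico hR.ne]
    intro r hr
    rcases hr.2.lt_or_eq with hlt | heq
    · exact (ad r hlt).continuousAt.continuousWithinAt
    · subst heq
      unfold ContinuousWithinAt
      rw [aR]
      have hz : Filter.Tendsto (fun x => M * H x) (nhdsWithin r (Icc 0 r)) (nhds 0) := by
        have : Filter.Tendsto (fun x => M * H x) (nhds r) (nhds (M * H r)) :=
          (continuous_const.mul Hc).continuousAt
        rw [Heq r hr, h0, mul_zero] at this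
        exact this.mono_left nhdsWithin_le_nhds
      apply tendsto_of_tendsto_of_tendsto_of_le_of_le' tendsto_const_nhds hz
      · filter_upwards with x
        simp only [ha]
        split_ifs
        · exact (Epos x).le
        · exact le_rfl
      · filter_upwards [self_mem_nhdsWithin] with x hx
        rcases hx.2.lt_or_eq with h1 | h1
        · rw [aE x h1]; exact hM x ⟨hx.1, h1⟩
        · rw [h1, aR, Heq r hr, h0, mul_zero]
  have alip' := alip.closure acont
  rw [closure_Ico hR.ne] at alip'
  have a0 : a 0 = 1 := by rw [aE 0 hR, E0]
  refine ⟨a, ⟨⟨_, alip'⟩, aR, by rw [a0]; exact one_ne_zero⟩, a0, fun r hr => ?_⟩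
  rw [(ad r hr.2).deriv, aE r hr.2, Heq r (Ioo_subset_Icc_self hr)]

theorem stmt_1 (R : ℝ) (hR : 0 < R) (h : ℝ → ℝ) (hH : SatisfiesH R h)
    (k : ℕ) (hk : 1 ≤ k) :
    steklov R 2 k h = (k : ℝ) / h 0 ∧
    sInf { v : ℝ | ∃ a : ℝ → ℝ, IsAdmissible R a ∧
        v = (∫ r in (0:ℝ)..R, (deriv a r) ^ 2 * h r + (k : ℝ) ^ 2 * (a r) ^ 2 / h r) /
              ((a 0) ^ 2 * h 0) } = (k : ℝ) / h 0 := by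
  have h0pos : 0 < h 0 := hH.2.1 0 ⟨le_rfl, hR⟩
  have main : sInf { v : ℝ | ∃ a : ℝ → ℝ, IsAdmissible R a ∧
        v = (∫ r in (0:ℝ)..R, (deriv a r) ^ 2 * h r + (k : ℝ) ^ 2 * (a r) ^ 2 / h r) /
              ((a 0) ^ 2 * h 0) } = (k : ℝ) / h 0 := by
    apply IsLeast.csInf_eq
    constructor
    · obtain ⟨a, ha, ha0, had⟩ := exists_min hR hH (k := (k:ℝ)) (by exact_mod_cast hk)
      refine ⟨a, ha, ?_⟩
      have : ∫ r in (0:ℝ)..R, (deriv a r) ^ 2 * h r + (k : ℝ) ^ 2 * (a r) ^ 2 / h r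
          = ∫ r in (0:ℝ)..R, -2 * (k:ℝ) * (a r * deriv a r) := by
        rw [intervalIntegral.integral_of_le hR.le, intervalIntegral.integral_of_le hR.le,
          integral_Ioc_eq_integral_Ioo, integral_Ioc_eq_integral_Ioo]
        apply setIntegral_congr_fun measurableSet_Ioo
        intro r hr
        have hpos := hH.2.1 r ⟨hr.1.le, hr.2⟩
        simp only
        rw [had r hr]
        field_simp
        ring
      rw [this, (key_int hR ha k).2, ha0]
      simp
    · rintro v ⟨a, ha, rfl⟩
      have h1 := lower_bd hR hH ha k
      have h2 : 0 < a 0 ^ 2 := by have := ha.2.2; positivity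
      rw [div_le_div_iff₀ h0pos (by positivity)]
      nlinarith [mul_le_mul_of_nonneg_right h1 h0pos.le]
  refine ⟨?_, main⟩
  rw [← main, steklov]
  congr 1
  ext v
  have e : ∀ a, rayleighQ R 2 (sphereEig 2 k) h a =
      (∫ r in (0:ℝ)..R, (deriv a r) ^ 2 * h r + (k : ℝ) ^ 2 * (a r) ^ 2 / h r) /
              ((a 0) ^ 2 * h 0) := by
    intro a
    have e1 : ((2:ℕ):ℤ) - 1 = 1 := by norm_num
    have e2 : ((2:ℕ):ℤ) - 3 = -1 := by norm_num
    have e3 : sphereEig 2 k = (k:ℝ) ^ 2 := by simp [sphereEig]; ring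
    simp only [rayleighQ, e1, e2, e3, zpow_one, zpow_neg_one, div_eq_mul_inv]
  simp only [e]
end

section
/- Let n ≥ 3 be an integer and let k ≥ 1 be an integer. Then the supremum, over all functions h satisfying hypotheses (H), of the Steklov spectral ratio σ_(k+1)(g_h)/σ_(k)(g_h) equals λ_(k+1)/λ_(k); that is, σ_(k+1)(g_h)/σ_(k)(g_h) ≤ λ_(k+1)/λ_(k) for every such h, and for every ε > 0 there exists h satisfying (H) with σ_(k+1)(g_h)/σ_(k)(g_h) > λ_(k+1)/λ_(k) − ε. -/
open MeasureTheory Set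

lemma energy_eq (R : ℝ) (m : ℕ) (lam : ℝ) (h a : ℝ → ℝ) :
    rayleighQ R (m + 3) lam h a =
      (∫ r in (0:ℝ)..R, (deriv a r) ^ 2 * h r ^ (m + 2) + lam * (a r) ^ 2 * h r ^ m) /
        ((a 0) ^ 2 * h 0 ^ (m + 2)) := by
  unfold rayleighQ
  have e1 : ((m + 3 : ℕ) : ℤ) - 1 = ((m + 2 : ℕ) : ℤ) := by push_cast; ring
  have e2 : ((m + 3 : ℕ) : ℤ) - 3 = ((m : ℕ) : ℤ) := by push_cast; ring
  simp only [e1, e2, zpow_natCast]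

lemma kin_integrable {R : ℝ} (hR : 0 < R) {h a : ℝ → ℝ} (hc : ContinuousOn h (Icc 0 R))
    {K : NNReal} (ha : LipschitzOnWith K a (Icc 0 R)) (j : ℕ) :
    IntervalIntegrable (fun r => (deriv a r) ^ 2 * h r ^ j) volume 0 R := by
  have h1 : IntervalIntegrable (fun r => (deriv a r) ^ 2) volume 0 R := by
    rw [intervalIntegrable_iff_integrableOn_Ioo_of_le hR.le]
    refine Measure.integrableOn_of_bounded (M := (K : ℝ) ^ 2) (by simp)
      ((measurable_deriv a).pow_const 2).aestronglyMeasurable ?_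
    refine (ae_restrict_iff' measurableSet_Ioo).2 (Filter.Eventually.of_forall fun r hr => ?_)
    have := norm_deriv_le_of_lipschitzOn (Icc_mem_nhds hr.1 hr.2) ha
    rw [norm_pow]
    exact pow_le_pow_left₀ (norm_nonneg _) this 2
  refine h1.mul_continuousOn ?_
  rw [uIcc_of_le hR.le]
  exact hc.pow j

lemma pot_integrable {R : ℝ} (hR : 0 < R) {h a : ℝ → ℝ} (hc : ContinuousOn h (Icc 0 R))
    {K : NNReal} (ha : LipschitzOnWith K a (Icc 0 R)) (lam : ℝ) (j : ℕ) :
    IntervalIntegrable (fun r => lam * (a r) ^ 2 * h r ^ j) volume 0 R := by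
  apply ContinuousOn.intervalIntegrable
  rw [uIcc_of_le hR.le]
  exact (continuousOn_const.mul (ha.continuousOn.pow 2)).mul (hc.pow j)

lemma en_integrable {R : ℝ} (hR : 0 < R) {h a : ℝ → ℝ} (hc : ContinuousOn h (Icc 0 R))
    {K : NNReal} (ha : LipschitzOnWith K a (Icc 0 R)) (lam : ℝ) (m : ℕ) :
    IntervalIntegrable (fun r => (deriv a r) ^ 2 * h r ^ (m + 2) + lam * (a r) ^ 2 * h r ^ m)
      volume 0 R :=
  (kin_integrable hR hc ha _).add (pot_integrable hR hc ha lam _)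

lemma h_nonneg {R : ℝ} {h : ℝ → ℝ} (H : SatisfiesH R h) : ∀ r ∈ Icc (0:ℝ) R, 0 ≤ h r := by
  intro r hr
  rcases eq_or_lt_of_le hr.2 with e | e
  · rw [e, H.2.2.1]
  · exact (H.2.1 r ⟨hr.1, e⟩).le

lemma ray_nonneg {R : ℝ} (hR : 0 < R) {h a : ℝ → ℝ} (H : SatisfiesH R h) (m : ℕ) {lam : ℝ}
    (hl : 0 ≤ lam) : 0 ≤ rayleighQ R (m + 3) lam h a := by
  rw [energy_eq]
  have h0 := h_nonneg H 0 ⟨le_rfl, hR.le⟩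
  refine div_nonneg (intervalIntegral.integral_nonneg hR.le fun r hr => ?_) (by positivity)
  have := h_nonneg H r hr
  positivity

lemma ray_le {R : ℝ} (hR : 0 < R) {h a : ℝ → ℝ} (H : SatisfiesH R h) (m : ℕ) {lam mu : ℝ}
    (hl : 0 < lam) (hlm : lam ≤ mu) (ha : IsAdmissible R a) :
    rayleighQ R (m + 3) mu h a ≤ mu / lam * rayleighQ R (m + 3) lam h a := by
  obtain ⟨⟨K, hK⟩, -, -⟩ := ha
  have h0 := h_nonneg H 0 ⟨le_rfl, hR.le⟩
  rw [energy_eq, energy_eq, ← mul_div_assoc, ← intervalIntegral.integral_const_mul]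
  refine div_le_div_of_nonneg_right ?_ (by positivity)
  refine intervalIntegral.integral_mono_on hR.le (en_integrable hR H.1.continuousOn hK _ _)
    ((en_integrable hR H.1.continuousOn hK _ _).const_mul _) fun r hr => ?_
  have := h_nonneg H r hr
  have h1 : 1 ≤ mu / lam := (one_le_div hl).2 hlm
  have h2 : 0 ≤ (deriv a r) ^ 2 * h r ^ (m + 2) := by positivity
  have h3 : mu / lam * (lam * a r ^ 2 * h r ^ m) = mu * a r ^ 2 * h r ^ m := by field_simp
  rw [mul_add, h3]
  nlinarith

lemma set_nonempty {R : ℝ} (hR : 0 < R) (n : ℕ) (lam : ℝ) (h : ℝ → ℝ) :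
    { v : ℝ | ∃ a : ℝ → ℝ, IsAdmissible R a ∧ v = rayleighQ R n lam h a }.Nonempty := by
  refine ⟨_, fun r => R - r, ⟨⟨1, ?_⟩, by simp, by simpa using hR.ne'⟩, rfl⟩
  refine LipschitzOnWith.of_dist_le_mul fun x _ y _ => ?_
  rw [Real.dist_eq, Real.dist_eq, show R - x - (R - y) = -(x - y) by ring, abs_neg]
  simp

lemma set_bdd {R : ℝ} (hR : 0 < R) {h : ℝ → ℝ} (H : SatisfiesH R h) (m : ℕ) {lam : ℝ}
    (hl : 0 ≤ lam) :
    BddBelow { v : ℝ | ∃ a : ℝ → ℝ, IsAdmissible R a ∧ v = rayleighQ R (m + 3) lam h a } := by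
  refine ⟨0, ?_⟩
  rintro v ⟨a, -, rfl⟩
  exact ray_nonneg hR H m hl

lemma eig_pos (m k : ℕ) (hk : 1 ≤ k) : 0 < sphereEig (m + 3) k := by
  unfold sphereEig
  have : (1:ℝ) ≤ k := by exact_mod_cast hk
  have : (0:ℝ) ≤ m := by positivity
  push_cast
  apply mul_pos <;> linarith

lemma eig_le (m k : ℕ) (hk : 1 ≤ k) : sphereEig (m + 3) k ≤ sphereEig (m + 3) (k + 1) := by
  unfold sphereEig
  have : (1:ℝ) ≤ k := by exact_mod_cast hk
  have : (0:ℝ) ≤ m := by positivity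
  push_cast
  nlinarith

lemma part_one {R : ℝ} (hR : 0 < R) (m k : ℕ) (hk : 1 ≤ k) {h : ℝ → ℝ} (H : SatisfiesH R h) :
    steklov R (m + 3) (k + 1) h / steklov R (m + 3) k h ≤
      sphereEig (m + 3) (k + 1) / sphereEig (m + 3) k := by
  have hl := eig_pos m k hk
  have hm := eig_pos m (k + 1) (by omega)
  have hs : 0 ≤ steklov R (m + 3) k h := by
    apply Real.sInf_nonneg
    rintro v ⟨a, -, rfl⟩
    exact ray_nonneg hR H m hl.le
  rcases hs.eq_or_lt with e | e
  · rw [← e, div_zero]; positivity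
  rw [div_le_iff₀ e, mul_comm, ← div_le_iff₀ (by positivity)]
  refine le_csInf (set_nonempty hR _ _ _) ?_
  rintro v ⟨a, ha, rfl⟩
  rw [div_le_iff₀ (by positivity), mul_comm]
  exact (csInf_le (set_bdd hR H m hm.le) ⟨a, ha, rfl⟩).trans
    (ray_le hR H m hl (eig_le m k hk) ha)

lemma lower_energy {R L M mu t : ℝ} (hL : 0 < L) (hLR : L ≤ R) (hM : 0 < M)
    (hmu : t ≤ mu) (ht : 0 ≤ t) (hM2 : (mu * R) ^ 2 ≤ t * M ^ 2) {h a : ℝ → ℝ}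
    (hc : ContinuousOn h (Icc 0 R)) (hnn : ∀ r ∈ Icc (0:ℝ) R, 0 ≤ h r)
    (hconst : ∀ r ∈ Icc (0:ℝ) L, h r = M) {K : NNReal}
    (ha : LipschitzOnWith K a (Icc 0 R)) (m : ℕ) :
    M ^ m * ((mu - t) * L) * (a 0) ^ 2 ≤
      ∫ r in (0:ℝ)..R, (deriv a r) ^ 2 * h r ^ (m + 2) + mu * (a r) ^ 2 * h r ^ m := by
  have hR : 0 < R := hL.trans_le hLR
  have hint := en_integrable hR hc ha mu m
  have sub1 : uIcc 0 L ⊆ uIcc 0 R := by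
    rw [uIcc_of_le hL.le, uIcc_of_le hR.le]; exact Icc_subset_Icc_right hLR
  have sub2 : uIcc L R ⊆ uIcc 0 R := by
    rw [uIcc_of_le hLR, uIcc_of_le hR.le]; exact Icc_subset_Icc_left hL.le
  rw [← intervalIntegral.integral_add_adjacent_intervals (hint.mono_set sub1)
    (hint.mono_set sub2)]
  have hpos : 0 ≤ ∫ r in L..R, (deriv a r) ^ 2 * h r ^ (m + 2) + mu * (a r) ^ 2 * h r ^ m := by
    refine intervalIntegral.integral_nonneg hLR fun r hr => ?_
    have := hnn r ⟨hL.le.trans hr.1, hr.2⟩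
    have : 0 ≤ mu := ht.trans hmu
    positivity
  have hac : AbsolutelyContinuousOnInterval a 0 L := by
    apply LipschitzOnWith.absolutelyContinuousOnInterval (K := K)
    exact ha.mono (by rw [uIcc_of_le hL.le]; exact Icc_subset_Icc_right hLR)
  have hpc : AbsolutelyContinuousOnInterval (fun r => (mu - t) * (L - r)) 0 L := by
    apply LipschitzOnWith.absolutelyContinuousOnInterval (K := ⟨mu - t, by linarith⟩)
    refine LipschitzOnWith.of_dist_le_mul fun x _ y _ => ?_
    change _ ≤ (mu - t) * _
    rw [Real.dist_eq, Real.dist_eq, ← mul_sub, abs_mul, abs_of_nonneg (by linarith : 0 ≤ mu - t)]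
    rw [show L - x - (L - y) = -(x - y) by ring, abs_neg]
  have hF := hpc.fun_mul (hac.fun_mul hac)
  have hFTC := hF.integral_deriv_eq_sub
  have hle : ∫ r in (0:ℝ)..L, -(M ^ m) * deriv (fun r => (mu - t) * (L - r) * (a r * a r)) r ≤
      ∫ r in (0:ℝ)..L, (deriv a r) ^ 2 * h r ^ (m + 2) + mu * (a r) ^ 2 * h r ^ m := by
    refine intervalIntegral.integral_mono_ae_restrict hL.le
      (hF.intervalIntegrable_deriv.const_mul _) (hint.mono_set sub1) ?_
    refine (ae_restrict_iff' measurableSet_Icc).2 ?_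
    filter_upwards [hac.ae_differentiableAt] with r hr hrL
    have hd := (hr (by rwa [uIcc_of_le hL.le])).hasDerivAt
    have hp : HasDerivAt (fun r => (mu - t) * (L - r)) ((mu - t) * (-1)) r :=
      ((hasDerivAt_id r).const_sub L).const_mul (mu - t)
    have hder := (hp.fun_mul (hd.fun_mul hd)).deriv
    rw [hder, hconst r hrL]
    set D := deriv a r
    set A := a r
    set p := (mu - t) * (L - r) with hpdef
    have hp0 : 0 ≤ p := mul_nonneg (by linarith) (by linarith [hrL.2])
    have hpR : p ≤ mu * R :=
      mul_le_mul (by linarith) (by linarith [hrL.1]) (by linarith [hrL.2]) (by linarith)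
    have hp2 : p ^ 2 ≤ t * M ^ 2 := (pow_le_pow_left₀ hp0 hpR 2).trans hM2
    have hp3 : p ^ 2 / M ^ 2 ≤ t := by rwa [div_le_iff₀ (by positivity)]
    have key : -((mu - t) * (-1) * (A * A) + p * (D * A + A * D)) ≤ M ^ 2 * D ^ 2 + mu * A ^ 2 := by
      have e : (M * D + p * A / M) ^ 2 = M ^ 2 * D ^ 2 + 2 * p * A * D + p ^ 2 / M ^ 2 * A ^ 2 := by
        field_simp; ring
      nlinarith [sq_nonneg (M * D + p * A / M), mul_le_mul_of_nonneg_right hp3 (sq_nonneg A)]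
    have := mul_le_mul_of_nonneg_left key (pow_nonneg hM.le m)
    calc _ = M ^ m * -((mu - t) * (-1) * (A * A) + p * (D * A + A * D)) := by ring
      _ ≤ _ := this
      _ = _ := by ring
  rw [intervalIntegral.integral_const_mul, hFTC] at hle
  have e : -(M ^ m) * ((mu - t) * (L - L) * (a L * a L) - (mu - t) * (L - 0) * (a 0 * a 0)) =
    M ^ m * ((mu - t) * L) * (a 0) ^ 2 := by ring
  linarith

noncomputable def testH (R M d : ℝ) (r : ℝ) : ℝ :=
  (R - r) * (1 - Real.smoothTransition ((R - r - d) / d)) +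
    M * Real.smoothTransition ((R - r - d) / d)

lemma testH_tip {R M d r : ℝ} (hd : 0 < d) (hr : R - d ≤ r) : testH R M d r = R - r := by
  have : Real.smoothTransition ((R - r - d) / d) = 0 :=
    Real.smoothTransition.zero_of_nonpos (div_nonpos_of_nonpos_of_nonneg (by linarith) hd.le)
  simp [testH, this]

lemma testH_body {R M d r : ℝ} (hd : 0 < d) (hr : r ≤ R - 2 * d) : testH R M d r = M := by
  have : Real.smoothTransition ((R - r - d) / d) = 1 :=
    Real.smoothTransition.one_of_one_le ((one_le_div hd).2 (by linarith))
  simp [testH, this]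

lemma testH_le {R M d r : ℝ} (hM : R ≤ M) (hr : 0 ≤ r) : testH R M d r ≤ M := by
  unfold testH
  have h1 := Real.smoothTransition.nonneg ((R - r - d) / d)
  have h2 := Real.smoothTransition.le_one ((R - r - d) / d)
  nlinarith

lemma testH_smooth (R M d : ℝ) : ContDiff ℝ (⊤ : ℕ∞) (testH R M d) := by
  unfold testH
  have : ContDiff ℝ (⊤ : ℕ∞) (fun r : ℝ => Real.smoothTransition ((R - r - d) / d)) :=
    Real.smoothTransition.contDiff.comp (by fun_prop)
  fun_prop

lemma testH_H {R M d : ℝ} (hR : 0 < R) (hM : 0 < M) (hd : 0 < d) :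
    SatisfiesH R (testH R M d) := by
  have hmem : R ∈ Icc (0:ℝ) R := ⟨hR.le, le_rfl⟩
  have hev : testH R M d =ᶠ[nhdsWithin R (Icc 0 R)] fun r => R - r := by
    apply Filter.Eventually.filter_mono nhdsWithin_le_nhds
    filter_upwards [lt_mem_nhds (show R - d < R by linarith)] with r hr
    exact testH_tip hd hr.le
  have hRR : testH R M d R = R - R := testH_tip hd (by linarith)
  refine ⟨(testH_smooth R M d).contDiffOn, ?_, by simp [hRR], ?_, ?_⟩
  · intro r hr
    unfold testH
    have h1 := Real.smoothTransition.nonneg ((R - r - d) / d)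
    have h2 := Real.smoothTransition.le_one ((R - r - d) / d)
    have h3 : 0 < R - r := by linarith [hr.2]
    rcases h1.eq_or_lt with e | e
    · rw [← e]; simpa using hr.2
    · have := mul_pos hM e
      nlinarith
  · rw [hev.derivWithin_eq hRR]
    exact ((hasDerivAt_id R).const_sub R).hasDerivWithinAt.derivWithin
      (uniqueDiffOn_Icc hR R hmem)
  · intro k
    rw [hev.iteratedDerivWithin_eq hRR,
      iteratedDerivWithin_eq_iteratedDeriv (uniqueDiffOn_Icc hR) (by fun_prop) hmem]
    cases k with
    | zero => simp
    | succ k =>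
      have hder : deriv (fun r : ℝ => R - r) = fun _ => (-1 : ℝ) := by
        funext r
        exact ((hasDerivAt_id r).const_sub R).deriv
      rw [show 2 * (k + 1) = (2 * k + 1) + 1 by ring, iteratedDeriv_succ', hder,
        iteratedDeriv_const]
      simp

lemma upper_test {R M d lam : ℝ} (hR : 0 < R) (hM1 : 1 ≤ M) (hMR : R ≤ M) (hd : 0 < d)
    (hd1 : d ≤ 1) (hdR : 2 * d < R) (hl : 0 < lam) (m : ℕ) :
    ∃ a, IsAdmissible R a ∧ rayleighQ R (m + 3) lam (testH R M d) a ≤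
      M ^ m * (lam * R + d) / M ^ (m + 2) := by
  have hM : 0 < M := by linarith
  have H := testH_H hR hM hd
  have hlin : LipschitzWith ⟨1 / d, by positivity⟩ (fun r : ℝ => (R - r) / d) := by
    refine LipschitzWith.of_dist_le_mul fun x y => ?_
    change _ ≤ 1 / d * _
    rw [Real.dist_eq, Real.dist_eq, show (R - x) / d - (R - y) / d = 1 / d * -(x - y) by ring,
      abs_mul, abs_neg, abs_of_nonneg (by positivity : 0 ≤ 1 / d)]
  have hlip : LipschitzWith ⟨1 / d, by positivity⟩ (fun r : ℝ => min 1 ((R - r) / d)) :=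
    hlin.const_min 1
  set a : ℝ → ℝ := fun r : ℝ => min 1 ((R - r) / d) with hadef
  have ha0 : a 0 = 1 := by
    simp only [hadef, sub_zero]
    exact min_eq_left ((one_le_div hd).2 (by linarith))
  have haR : a R = 0 := by simp [hadef]
  have hadm : IsAdmissible R a := ⟨⟨_, hlip.lipschitzOnWith⟩, haR, by simp [ha0]⟩
  refine ⟨a, hadm, ?_⟩
  rw [energy_eq, ha0, testH_body hd (by linarith), one_pow, one_mul]
  refine div_le_div_of_nonneg_right ?_ (by positivity)
  have hint := en_integrable hR H.1.continuousOn (hlip.lipschitzOnWith (s := Icc 0 R)) lam m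
  have sub1 : uIcc 0 (R - d) ⊆ uIcc 0 R := by
    rw [uIcc_of_le (by linarith), uIcc_of_le hR.le]; exact Icc_subset_Icc_right (by linarith)
  have sub2 : uIcc (R - d) R ⊆ uIcc 0 R := by
    rw [uIcc_of_le (by linarith), uIcc_of_le hR.le]; exact Icc_subset_Icc_left (by linarith)
  have hpot : ∀ r ∈ Icc (0:ℝ) R, lam * a r ^ 2 * testH R M d r ^ m ≤ lam * M ^ m := by
    intro r hr
    have h1 : 0 ≤ a r := le_min zero_le_one (div_nonneg (by linarith [hr.2]) hd.le)
    have h2 : a r ≤ 1 := min_le_left _ _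
    have h3 : a r ^ 2 ≤ 1 := pow_le_one₀ h1 h2
    have h4 := h_nonneg H r hr
    have h5 : testH R M d r ^ m ≤ M ^ m := pow_le_pow_left₀ h4 (testH_le hMR hr.1) m
    exact mul_le_mul (by nlinarith) h5 (by positivity) hl.le
  rw [← intervalIntegral.integral_add_adjacent_intervals (hint.mono_set sub1)
    (hint.mono_set sub2)]
  have I1 : ∫ r in (0:ℝ)..(R - d), (deriv a r) ^ 2 * testH R M d r ^ (m + 2) +
      lam * (a r) ^ 2 * testH R M d r ^ m ≤ ∫ r in (0:ℝ)..(R - d), lam * M ^ m := by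
    refine intervalIntegral.integral_mono_on_of_le_Ioo (by linarith) (hint.mono_set sub1)
      (by simp) fun r hr => ?_
    have hda : deriv a r = 0 := by
      have : a =ᶠ[nhds r] fun _ => (1:ℝ) := by
        filter_upwards [gt_mem_nhds hr.2] with x hx
        exact min_eq_left ((one_le_div hd).2 (by linarith))
      rw [this.deriv_eq, deriv_const]
    have := hpot r ⟨hr.1.le, by linarith [hr.2]⟩
    rw [hda]; simpa using this
  have I2 : ∫ r in (R - d)..R, (deriv a r) ^ 2 * testH R M d r ^ (m + 2) +
      lam * (a r) ^ 2 * testH R M d r ^ m ≤ ∫ r in (R - d)..R, (1 + lam * M ^ m) := by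
    refine intervalIntegral.integral_mono_on_of_le_Ioo (by linarith) (hint.mono_set sub2)
      (by simp) fun r hr => ?_
    refine add_le_add ?_ (hpot r ⟨by linarith [hr.1], hr.2.le⟩)
    rw [testH_tip hd hr.1.le]
    have h1 : ‖deriv a r‖ ≤ 1 / d := norm_deriv_le_of_lipschitz hlip
    have h2 : (deriv a r) ^ 2 ≤ (1 / d) ^ 2 := by
      rw [← sq_abs]; exact pow_le_pow_left₀ (abs_nonneg _) h1 2
    have h3 : (R - r) ^ (m + 2) ≤ d ^ (m + 2) :=
      pow_le_pow_left₀ (by linarith [hr.2]) (by linarith [hr.1]) _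
    have h4 : 0 ≤ R - r := by linarith [hr.2]
    calc _ ≤ (1 / d) ^ 2 * d ^ (m + 2) := mul_le_mul h2 h3 (by positivity) (by positivity)
      _ = d ^ m := by field_simp; ring
      _ ≤ 1 := pow_le_one₀ hd.le hd1
  rw [intervalIntegral.integral_const, smul_eq_mul] at I1 I2
  have hMm : 1 ≤ M ^ m := one_le_pow₀ hM1
  have hdm : d ≤ M ^ m * d := by nlinarith
  nlinarith

lemma steklov_lower {R M d t : ℝ} (hR : 0 < R) (hM : 0 < M) (hd : 0 < d)
    (hdR : 2 * d < R) (m k : ℕ) (hmu : t ≤ sphereEig (m + 3) k) (ht : 0 ≤ t)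
    (hM2 : (sphereEig (m + 3) k * R) ^ 2 ≤ t * M ^ 2) :
    M ^ m * ((sphereEig (m + 3) k - t) * (R - 2 * d)) / M ^ (m + 2) ≤
      steklov R (m + 3) k (testH R M d) := by
  have H := testH_H hR hM hd
  refine le_csInf (set_nonempty hR _ _ _) ?_
  rintro v ⟨a, ⟨⟨K, hK⟩, -, ha0⟩, rfl⟩
  rw [energy_eq, testH_body hd (by linarith), div_le_div_iff₀ (by positivity) (by positivity)]
  have := lower_energy (L := R - 2 * d) (by linarith) (by linarith) hM hmu ht hM2
    H.1.continuousOn (h_nonneg H) (fun r hr => testH_body hd hr.2) hK m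
  have := mul_le_mul_of_nonneg_right this (by positivity : 0 ≤ M ^ (m + 2))
  linarith

lemma part_two {R : ℝ} (hR : 0 < R) (m k : ℕ) (hk : 1 ≤ k) {ε : ℝ} (hε : 0 < ε) :
    ∃ h : ℝ → ℝ, SatisfiesH R h ∧ steklov R (m + 3) (k + 1) h / steklov R (m + 3) k h >
      sphereEig (m + 3) (k + 1) / sphereEig (m + 3) k - ε := by
  have hl := eig_pos m k hk
  have hlm := eig_le m k hk
  set lam := sphereEig (m + 3) k with hlam
  set mu := sphereEig (m + 3) (k + 1) with hmu
  have hcont : Filter.Tendsto (fun t : ℝ => (mu - t) * (R - 2 * t) / (lam * R + t))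
      (nhdsWithin 0 (Ioi 0)) (nhds ((mu - 0) * (R - 2 * 0) / (lam * R + 0))) := by
    refine Filter.Tendsto.mono_left ?_ nhdsWithin_le_nhds
    have : ContinuousAt (fun t : ℝ => (mu - t) * (R - 2 * t) / (lam * R + t)) 0 := by
      refine ContinuousAt.div (by fun_prop) (by fun_prop) ?_
      simp only [add_zero]; positivity
    exact this
  have hlim : mu / lam - ε < (mu - 0) * (R - 2 * 0) / (lam * R + 0) := by
    have : (mu - 0) * (R - 2 * 0) / (lam * R + 0) = mu / lam := by
      simp only [sub_zero, mul_zero, add_zero]; field_simp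
    linarith
  have hsmall : ∀ c : ℝ, 0 < c → ∀ᶠ t in nhdsWithin (0:ℝ) (Ioi 0), t < c := fun c hc =>
    Filter.Eventually.filter_mono nhdsWithin_le_nhds (gt_mem_nhds hc)
  have hself : ∀ᶠ t in nhdsWithin (0:ℝ) (Ioi 0), 0 < t := self_mem_nhdsWithin
  obtain ⟨t, h1, ht, ht1, htR, htl⟩ := ((hcont.eventually (lt_mem_nhds hlim)).and
    (hself.and ((hsmall 1 one_pos).and
      ((hsmall (R / 2) (by positivity)).and (hsmall lam hl))))).exists
  set M : ℝ := 1 + R + (mu * R) ^ 2 / t with hMdef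
  have hq : 0 ≤ (mu * R) ^ 2 / t := by positivity
  have hM1 : 1 ≤ M := by linarith
  have hMR : R ≤ M := by linarith
  have hM : 0 < M := by linarith
  have hM2 : (mu * R) ^ 2 ≤ t * M ^ 2 := by
    have e1 : (mu * R) ^ 2 / t ≤ M := by linarith
    have e2 : M ≤ M ^ 2 := by nlinarith
    have e3 := e1.trans e2
    rw [div_le_iff₀ ht] at e3
    linarith
  have hM2' : (lam * R) ^ 2 ≤ t * M ^ 2 := le_trans (by gcongr) hM2
  have H := testH_H hR hM ht
  refine ⟨_, H, ?_⟩
  have lo1 := steklov_lower hR hM ht (by linarith) m (k + 1) (by linarith) ht.le hM2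
  have lo2 := steklov_lower hR hM ht (by linarith) m k (by linarith) ht.le hM2'
  obtain ⟨a, ha, hau⟩ := upper_test hR hM1 hMR ht ht1.le (by linarith) hl m
  have up : steklov R (m + 3) k (testH R M t) ≤ M ^ m * (lam * R + t) / M ^ (m + 2) :=
    (csInf_le (set_bdd hR H m hl.le) ⟨a, ha, rfl⟩).trans hau
  rw [← hmu] at lo1
  rw [← hlam] at lo2
  have p1 : 0 < mu - t := by linarith
  have p2 : 0 < lam - t := by linarith
  have p3 : 0 < R - 2 * t := by linarith
  have pos2 : 0 < steklov R (m + 3) k (testH R M t) := lt_of_lt_of_le (by positivity) lo2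
  refine lt_of_lt_of_le h1 ?_
  calc (mu - t) * (R - 2 * t) / (lam * R + t)
      = (M ^ m * ((mu - t) * (R - 2 * t)) / M ^ (m + 2)) /
        (M ^ m * (lam * R + t) / M ^ (m + 2)) := by field_simp
    _ ≤ _ := div_le_div₀ (le_trans (by positivity) lo1) lo1 pos2 up

theorem stmt_2 (n : ℕ) (hn : 3 ≤ n) (R : ℝ) (hR : 0 < R) (k : ℕ) (hk : 1 ≤ k) :
    (∀ h : ℝ → ℝ, SatisfiesH R h →
      steklov R n (k + 1) h / steklov R n k h ≤ sphereEig n (k + 1) / sphereEig n k) ∧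
    ∀ ε : ℝ, 0 < ε → ∃ h : ℝ → ℝ, SatisfiesH R h ∧
      steklov R n (k + 1) h / steklov R n k h > sphereEig n (k + 1) / sphereEig n k - ε := by
  obtain ⟨m, rfl⟩ : ∃ m, n = m + 3 := ⟨n - 3, by omega⟩
  exact ⟨fun h H => part_one hR m k hk H, fun ε hε => part_two hR m k hk hε⟩
end

section
/- Let n ≥ 3 be an integer, let h satisfy hypotheses (H), and let k ≥ 1 be an integer. Suppose there exist C2 > C1 > 0 and 0 < R1 < R such that h(r) ≤ C2 for all 0 ≤ r ≤ R and h(r) ≥ C1 for all 0 ≤ r ≤ R1. Then σ_(k+1)(g_h)/σ_(k)(g_h) ≤ λ_(k+1)/λ_(k) − γ, where γ = min{ (1/(4R1)) · (C1^{2(n−1)}/C2^{2(n−2)}) · (λ_(k+1) − λ_(k)) · (R λ_(k)² + C2² λ_(k)/(R − R1))^{−1}, (C1^{4(n−2)}/C2^{2(2n−3)}) · (R1³/128) · (λ_(k+1) − λ_(k)) · (R + C2²/((R − R1) λ_(k)))^{−1} }. -/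
open MeasureTheory Set

/-- Measurable and bounded on `(0,R)`. -/
def GoodFn (R : ℝ) (u : ℝ → ℝ) : Prop :=
  AEStronglyMeasurable u (volume.restrict (Ioo 0 R)) ∧ ∃ C, ∀ x ∈ Ioo 0 R, |u x| ≤ C

lemma GoodFn.mul {R : ℝ} {u v : ℝ → ℝ} (hu : GoodFn R u) (hv : GoodFn R v) :
    GoodFn R (fun x => u x * v x) := by
  obtain ⟨hu1, C, hC⟩ := hu
  obtain ⟨hv1, D, hD⟩ := hv
  refine ⟨hu1.mul hv1, C * D, fun x hx => ?_⟩
  rw [abs_mul]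
  exact mul_le_mul (hC x hx) (hD x hx) (abs_nonneg _) ((abs_nonneg _).trans (hC x hx))

lemma GoodFn.of_continuousOn {R : ℝ} {u : ℝ → ℝ} (hu : ContinuousOn u (Icc 0 R)) :
    GoodFn R u := by
  refine ⟨(hu.mono Ioo_subset_Icc_self).aestronglyMeasurable measurableSet_Ioo, ?_⟩
  obtain ⟨C, hC⟩ := isCompact_Icc.exists_bound_of_continuousOn hu
  exact ⟨C, fun x hx => hC x (Ioo_subset_Icc_self hx)⟩

lemma GoodFn.ii {R : ℝ} (hR : 0 < R) {u : ℝ → ℝ} (hu : GoodFn R u) :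
    IntervalIntegrable u volume 0 R := by
  rw [intervalIntegrable_iff_integrableOn_Ioo_of_le hR.le]
  obtain ⟨hu1, C, hC⟩ := hu
  refine Integrable.of_bound hu1 C ?_
  exact (ae_restrict_iff' measurableSet_Ioo).2 (ae_of_all _ hC)

/-- Lipschitz on `[0,R]`. -/
def LipR (R : ℝ) (a : ℝ → ℝ) : Prop := ∃ K : NNReal, LipschitzOnWith K a (Set.Icc 0 R)

lemma LipR.good {R : ℝ} {a : ℝ → ℝ} (ha : LipR R a) : GoodFn R a := by
  obtain ⟨K, hK⟩ := ha
  exact GoodFn.of_continuousOn hK.continuousOn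

lemma LipR.good_deriv {R : ℝ} {a : ℝ → ℝ} (ha : LipR R a) : GoodFn R (deriv a) := by
  obtain ⟨K, hK⟩ := ha
  refine ⟨aestronglyMeasurable_deriv a _, K, fun x hx => ?_⟩
  exact norm_deriv_le_of_lipschitzOn (Icc_mem_nhds hx.1 hx.2) hK

lemma LipR.ae_diff {R : ℝ} {a : ℝ → ℝ} (ha : LipR R a) :
    ∀ᵐ x, x ∈ Ioo 0 R → DifferentiableAt ℝ a x := by
  obtain ⟨K, hK⟩ := ha
  filter_upwards [hK.ae_differentiableWithinAt_of_mem_real] with x hx hx2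
  exact (hx (Ioo_subset_Icc_self hx2)).differentiableAt (Icc_mem_nhds hx2.1 hx2.2)

lemma LipR.sub_smul {R : ℝ} {a p : ℝ → ℝ} (ha : LipR R a) (hp : LipR R p) (s : ℝ) :
    LipR R (fun x => a x - s * p x) := by
  obtain ⟨K, hK⟩ := ha
  obtain ⟨K', hK'⟩ := hp
  refine ⟨K + ‖s‖₊ * K', LipschitzOnWith.of_dist_le_mul fun x hx y hy => ?_⟩
  have h1 := hK.dist_le_mul x hx y hy
  have h2 := hK'.dist_le_mul x hx y hy
  rw [Real.dist_eq] at *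
  have : a x - s * p x - (a y - s * p y) = (a x - a y) - s * (p x - p y) := by ring
  rw [this]
  refine (abs_sub _ _).trans ?_
  rw [abs_mul]
  push_cast
  rw [add_mul, mul_assoc, Real.norm_eq_abs]
  gcongr

/-- Gradient form. -/
noncomputable def EA (R : ℝ) (m : ℕ) (h u v : ℝ → ℝ) : ℝ :=
  ∫ r in (0:ℝ)..R, deriv u r * deriv v r * h r ^ (m + 2)

/-- Mass form. -/
noncomputable def EB (R : ℝ) (m : ℕ) (h u v : ℝ → ℝ) : ℝ :=
  ∫ r in (0:ℝ)..R, u r * v r * h r ^ m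

section
variable {R : ℝ} {m : ℕ} {h : ℝ → ℝ}

lemma ii_EA (hR : 0 < R) (hc : ContinuousOn h (Icc 0 R)) {u v : ℝ → ℝ}
    (hu : LipR R u) (hv : LipR R v) :
    IntervalIntegrable (fun r => deriv u r * deriv v r * h r ^ (m + 2)) volume 0 R :=
  ((hu.good_deriv.mul hv.good_deriv).mul (GoodFn.of_continuousOn (hc.pow _))).ii hR

lemma ii_EB (hR : 0 < R) (hc : ContinuousOn h (Icc 0 R)) {u v : ℝ → ℝ}
    (hu : LipR R u) (hv : LipR R v) :
    IntervalIntegrable (fun r => u r * v r * h r ^ m) volume 0 R :=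
  ((hu.good.mul hv.good).mul (GoodFn.of_continuousOn (hc.pow _))).ii hR

lemma EA_sub (hR : 0 < R) (hc : ContinuousOn h (Icc 0 R)) {a p : ℝ → ℝ}
    (ha : LipR R a) (hp : LipR R p) (s : ℝ) :
    EA R m h (fun x => a x - s * p x) (fun x => a x - s * p x)
      = EA R m h a a - 2 * s * EA R m h a p + s ^ 2 * EA R m h p p := by
  unfold EA
  rw [← intervalIntegral.integral_const_mul, ← intervalIntegral.integral_const_mul,
    ← intervalIntegral.integral_sub (ii_EA hR hc ha ha) ((ii_EA hR hc ha hp).const_mul _),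
    ← intervalIntegral.integral_add
      ((ii_EA hR hc ha ha).sub ((ii_EA hR hc ha hp).const_mul _))
      ((ii_EA hR hc hp hp).const_mul _)]
  apply intervalIntegral.integral_congr_ae
  have hne : ∀ᵐ x : ℝ, x ≠ R := by simp [ae_iff]
  filter_upwards [ha.ae_diff, hp.ae_diff, hne] with x h1 h2 h3 h4
  rw [uIoc_of_le hR.le] at h4
  have h5 : x ∈ Ioo 0 R := ⟨h4.1, lt_of_le_of_ne h4.2 h3⟩
  have : deriv (fun x => a x - s * p x) x = deriv a x - s * deriv p x :=
    ((h1 h5).hasDerivAt.sub ((h2 h5).hasDerivAt.const_mul s)).deriv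
  rw [this]
  ring

lemma EB_sub (hR : 0 < R) (hc : ContinuousOn h (Icc 0 R)) {a p : ℝ → ℝ}
    (ha : LipR R a) (hp : LipR R p) (s : ℝ) :
    EB R m h (fun x => a x - s * p x) (fun x => a x - s * p x)
      = EB R m h a a - 2 * s * EB R m h a p + s ^ 2 * EB R m h p p := by
  unfold EB
  rw [← intervalIntegral.integral_const_mul, ← intervalIntegral.integral_const_mul,
    ← intervalIntegral.integral_sub (ii_EB hR hc ha ha) ((ii_EB hR hc ha hp).const_mul _),
    ← intervalIntegral.integral_add
      ((ii_EB hR hc ha ha).sub ((ii_EB hR hc ha hp).const_mul _))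
      ((ii_EB hR hc hp hp).const_mul _)]
  apply intervalIntegral.integral_congr
  intro x _
  simp only
  ring

lemma EA_nonneg (hR : 0 < R) (hp : ∀ x ∈ Icc 0 R, 0 ≤ h x) (a : ℝ → ℝ) : 0 ≤ EA R m h a a :=
  intervalIntegral.integral_nonneg hR.le fun x hx =>
    mul_nonneg (mul_self_nonneg _) (pow_nonneg (hp x hx) _)

lemma EB_nonneg (hR : 0 < R) (hp : ∀ x ∈ Icc 0 R, 0 ≤ h x) (a : ℝ → ℝ) : 0 ≤ EB R m h a a :=
  intervalIntegral.integral_nonneg hR.le fun x hx =>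
    mul_nonneg (mul_self_nonneg _) (pow_nonneg (hp x hx) _)

lemma rayleigh_eq (hR : 0 < R) (hc : ContinuousOn h (Icc 0 R)) {a : ℝ → ℝ} (ha : LipR R a)
    (L : ℝ) : rayleighQ R (m + 3) L h a
      = (EA R m h a a + L * EB R m h a a) / (a 0 ^ 2 * h 0 ^ (m + 2)) := by
  unfold rayleighQ EA EB
  have e1 : ((m + 3 : ℕ) : ℤ) - 1 = ((m + 2 : ℕ) : ℤ) := by push_cast; ring
  have e2 : ((m + 3 : ℕ) : ℤ) - 3 = ((m : ℕ) : ℤ) := by push_cast; ring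
  rw [e1, e2, ← intervalIntegral.integral_const_mul, ← intervalIntegral.integral_add
    (ii_EA hR hc ha ha) ((ii_EB hR hc ha ha).const_mul _)]
  simp only [zpow_natCast]
  congr 2
  funext x
  ring

/-- Case 1: the function drops to 1/2 before `R1`. -/
lemma case1 (hR : 0 < R) (hc : ContinuousOn h (Icc 0 R)) (hp : ∀ x ∈ Icc 0 R, 0 ≤ h x)
    {C1 R1 : ℝ} (hC1 : 0 < C1) (hR1 : 0 < R1) (hR1R : R1 < R)
    (hlb : ∀ r ∈ Set.Icc (0:ℝ) R1, C1 ≤ h r) {a : ℝ → ℝ} (ha : LipR R a) (ha0 : a 0 = 1)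
    {r0 : ℝ} (hr0 : r0 ∈ Icc 0 R1) (har : a r0 ≤ 1 / 2) :
    C1 ^ (m + 2) / (4 * R1) ≤ EA R m h a a := by
  have hii := ii_EA (m := m) hR hc ha ha
  have hsub : Icc 0 r0 ⊆ Icc 0 R := Icc_subset_Icc le_rfl (hr0.2.trans hR1R.le)
  have hii1 : IntervalIntegrable (fun r => deriv a r * deriv a r * h r ^ (m + 2)) volume 0 r0 :=
    hii.mono_set (by rw [uIcc_of_le hr0.1, uIcc_of_le hR.le]; exact hsub)
  have hd : IntervalIntegrable (deriv a) volume 0 r0 :=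
    (ha.good_deriv.ii hR).mono_set (by rw [uIcc_of_le hr0.1, uIcc_of_le hR.le]; exact hsub)
  have h1 : ∫ r in (0:ℝ)..r0, deriv a r * deriv a r * h r ^ (m + 2) ≤ EA R m h a a := by
    unfold EA
    apply intervalIntegral.integral_mono_interval le_rfl hr0.1 (hr0.2.trans hR1R.le) _ hii
    refine (ae_restrict_iff' measurableSet_Ioc).2 (ae_of_all _ fun x hx => ?_)
    exact mul_nonneg (mul_self_nonneg _) (pow_nonneg (hp x (Ioc_subset_Icc_self hx)) _)
  refine le_trans ?_ h1
  have hftc : ∫ r in (0:ℝ)..r0, deriv a r = a r0 - a 0 := by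
    obtain ⟨K, hK⟩ := ha
    have : LipschitzOnWith K a (uIcc 0 r0) := by
      rw [uIcc_of_le hr0.1]; exact hK.mono hsub
    exact this.absolutelyContinuousOnInterval.integral_deriv_eq_sub
  set c : ℝ := 1 / (2 * R1) with hcdef
  have hcpos : 0 < c := by positivity
  have hcR : c * R1 = 1 / 2 := by rw [hcdef]; field_simp
  have h2 : ∫ r in (0:ℝ)..r0, C1 ^ (m + 2) * (-(2 * c) * deriv a r - c ^ 2)
      ≤ ∫ r in (0:ℝ)..r0, deriv a r * deriv a r * h r ^ (m + 2) := by
    apply intervalIntegral.integral_mono_on hr0.1 _ hii1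
    · intro x hx
      have hx1 : C1 ≤ h x := hlb x ⟨hx.1, hx.2.trans hr0.2⟩
      have hx2 : C1 ^ (m + 2) ≤ h x ^ (m + 2) := pow_le_pow_left₀ hC1.le hx1 _
      calc _ ≤ C1 ^ (m + 2) * (deriv a x * deriv a x) := by
              apply mul_le_mul_of_nonneg_left _ (by positivity)
              nlinarith [sq_nonneg (deriv a x + c)]
        _ ≤ _ := by
              rw [mul_comm]
              exact mul_le_mul_of_nonneg_left hx2 (mul_self_nonneg _)
    · exact ((hd.const_mul _).sub intervalIntegrable_const).const_mul _
  refine le_trans ?_ h2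
  rw [intervalIntegral.integral_const_mul, intervalIntegral.integral_sub (hd.const_mul _)
    intervalIntegrable_const, intervalIntegral.integral_const_mul, hftc, ha0,
    intervalIntegral.integral_const, div_eq_mul_inv, smul_eq_mul, sub_zero]
  apply mul_le_mul_of_nonneg_left _ (by positivity)
  have : (4 * R1)⁻¹ = c / 2 := by rw [hcdef]; field_simp; norm_num
  rw [this]
  have : r0 * c ^ 2 ≤ c / 2 := by nlinarith [mul_le_mul_of_nonneg_right hr0.2 (sq_nonneg c)]
  nlinarith

/-- The bump. -/
noncomputable def bump (R1 : ℝ) : ℝ → ℝ := fun r => max (r * (R1 - r)) 0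

lemma bump_lip {R1 : ℝ} (hR : 0 < R) (hR1 : 0 < R1) : LipR R (bump R1) := by
  refine ⟨(R1 + 2 * R).toNNReal, LipschitzOnWith.of_dist_le_mul fun x hx y hy => ?_⟩
  rw [Real.dist_eq, Real.dist_eq, Real.coe_toNNReal _ (by positivity)]
  refine (abs_max_sub_max_le_abs _ _ _).trans ?_
  have : x * (R1 - x) - y * (R1 - y) = (R1 - x - y) * (x - y) := by ring
  rw [this, abs_mul]
  apply mul_le_mul_of_nonneg_right _ (abs_nonneg _)
  rw [abs_le]
  constructor <;> linarith [hx.1, hx.2, hy.1, hy.2]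

lemma bump_eq {R1 x : ℝ} (hx : x ∈ Icc 0 R1) : bump R1 x = x * (R1 - x) :=
  max_eq_left (mul_nonneg hx.1 (by linarith [hx.2]))

lemma bump_eq0 {R1 x : ℝ} (hR1 : 0 < R1) (hx : R1 ≤ x) : bump R1 x = 0 :=
  max_eq_right (by nlinarith)

lemma bump_deriv {R1 x : ℝ} (hx : x ∈ Ioo 0 R1) : deriv (bump R1) x = R1 - 2 * x := by
  have : bump R1 =ᶠ[nhds x] fun r => r * (R1 - r) := by
    filter_upwards [Ioo_mem_nhds hx.1 hx.2] with y hy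
    exact bump_eq (Ioo_subset_Icc_self hy)
  rw [this.deriv_eq]
  have := ((hasDerivAt_id x).mul ((hasDerivAt_id x).const_sub R1)).deriv
  simp only [id] at this
  refine Eq.trans ?_ (this.trans ?_)
  · rfl
  · ring

lemma bump_deriv0 {R1 x : ℝ} (hR1 : 0 < R1) (hx : R1 < x) : deriv (bump R1) x = 0 := by
  have : bump R1 =ᶠ[nhds x] fun _ => 0 := by
    filter_upwards [Ioi_mem_nhds hx] with y hy
    exact bump_eq0 hR1 (le_of_lt hy)
  rw [this.deriv_eq]
  simp

lemma EA_bump (hR : 0 < R) (hc : ContinuousOn h (Icc 0 R)) (hp : ∀ x ∈ Icc 0 R, 0 ≤ h x)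
    {C2 R1 : ℝ} (hR1 : 0 < R1) (hR1R : R1 < R)
    (hub : ∀ r ∈ Set.Icc (0:ℝ) R, h r ≤ C2) :
    EA R m h (bump R1) (bump R1) ≤ C2 ^ (m + 2) * (R1 ^ 3 / 3) := by
  have hii := ii_EA (m := m) hR hc (bump_lip hR hR1) (bump_lip hR hR1)
  have hmem : R1 ∈ uIcc 0 R := by rw [uIcc_of_le hR.le]; exact ⟨hR1.le, hR1R.le⟩
  have i1 := hii.mono_set (uIcc_subset_uIcc_left hmem)
  have i2 := hii.mono_set (uIcc_subset_uIcc_right hmem)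
  unfold EA
  rw [← intervalIntegral.integral_add_adjacent_intervals i1 i2]
  have z : ∫ r in R1..R, deriv (bump R1) r * deriv (bump R1) r * h r ^ (m + 2) = 0 := by
    rw [intervalIntegral.integral_congr_ae (g := fun _ => 0)]
    · simp
    · refine ae_of_all _ fun x hx => ?_
      rw [uIoc_of_le hR1R.le] at hx
      simp [bump_deriv0 hR1 hx.1]
  have e : ∫ r in (0:ℝ)..R1, C2 ^ (m + 2) * (R1 - 2 * r) ^ 2 = C2 ^ (m + 2) * (R1 ^ 3 / 3) := by
    rw [intervalIntegral.integral_const_mul]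
    congr 1
    have := intervalIntegral.integral_comp_sub_mul (a := 0) (b := R1) (fun y : ℝ => y ^ 2)
      (c := 2) (by norm_num) R1
    rw [this, integral_pow]
    simp only [smul_eq_mul]
    push_cast
    ring
  rw [z, add_zero, ← e]
  apply intervalIntegral.integral_mono_on_of_le_Ioo hR1.le i1
  · exact Continuous.intervalIntegrable (by fun_prop) _ _
  · intro x hx
    rw [bump_deriv hx]
    have hx' : x ∈ Icc 0 R := ⟨hx.1.le, hx.2.le.trans hR1R.le⟩
    have : h x ^ (m + 2) ≤ C2 ^ (m + 2) := pow_le_pow_left₀ (hp x hx') (hub x hx') _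
    nlinarith [mul_le_mul_of_nonneg_left this (sq_nonneg (R1 - 2 * x))]

lemma EB_bump (hR : 0 < R) (hc : ContinuousOn h (Icc 0 R))
    {C1 R1 : ℝ} (hC1 : 0 < C1) (hR1 : 0 < R1) (hR1R : R1 < R)
    (hlb : ∀ r ∈ Set.Icc (0:ℝ) R1, C1 ≤ h r) {a : ℝ → ℝ} (ha : LipR R a)
    (har : ∀ r ∈ Icc 0 R1, 1 / 2 ≤ a r) :
    C1 ^ m * (R1 ^ 3 / 12) ≤ EB R m h a (bump R1) := by
  have hii := ii_EB (m := m) hR hc ha (bump_lip hR hR1)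
  have hmem : R1 ∈ uIcc 0 R := by rw [uIcc_of_le hR.le]; exact ⟨hR1.le, hR1R.le⟩
  have i1 := hii.mono_set (uIcc_subset_uIcc_left hmem)
  have i2 := hii.mono_set (uIcc_subset_uIcc_right hmem)
  unfold EB
  rw [← intervalIntegral.integral_add_adjacent_intervals i1 i2]
  have z : ∫ r in R1..R, a r * bump R1 r * h r ^ m = 0 := by
    rw [intervalIntegral.integral_congr_ae (g := fun _ => 0)]
    · simp
    · refine ae_of_all _ fun x hx => ?_
      rw [uIoc_of_le hR1R.le] at hx
      simp [bump_eq0 hR1 hx.1.le]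
  have e : ∫ r in (0:ℝ)..R1, (C1 ^ m / 2) * (R1 * r - r ^ 2) = C1 ^ m * (R1 ^ 3 / 12) := by
    rw [intervalIntegral.integral_const_mul, intervalIntegral.integral_sub
      (Continuous.intervalIntegrable (by fun_prop) _ _)
      (Continuous.intervalIntegrable (by fun_prop) _ _), intervalIntegral.integral_const_mul,
      integral_id, integral_pow]
    push_cast
    ring
  rw [z, add_zero, ← e]
  apply intervalIntegral.integral_mono_on hR1.le _ i1
  · intro x hx
    rw [bump_eq hx]
    have h1 : C1 ^ m ≤ h x ^ m := pow_le_pow_left₀ hC1.le (hlb x hx) _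
    have h2 := har x hx
    have h3 : 0 ≤ x * (R1 - x) := mul_nonneg hx.1 (by linarith [hx.2])
    have h4 : 0 ≤ C1 ^ m := by positivity
    calc _ = (1 / 2 * (x * (R1 - x))) * C1 ^ m := by ring
      _ ≤ (a x * (x * (R1 - x))) * h x ^ m := by
        apply mul_le_mul _ h1 h4
        · exact mul_nonneg (by linarith) h3
        · exact mul_le_mul_of_nonneg_right h2 h3
  · exact Continuous.intervalIntegrable (by fun_prop) _ _

lemma key (hR : 0 < R) (hc : ContinuousOn h (Icc 0 R)) (hp : ∀ x ∈ Icc 0 R, 0 ≤ h x)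
    {C1 C2 R1 L M K : ℝ} (hC1 : 0 < C1) (hC12 : C1 < C2) (hR1 : 0 < R1) (hR1R : R1 < R)
    (hub : ∀ r ∈ Set.Icc (0:ℝ) R, h r ≤ C2) (hL : 0 < L)
    (hlb : ∀ r ∈ Set.Icc (0:ℝ) R1, C1 ≤ h r)
    (hM : ∀ b, LipR R b → b R = 0 → b 0 = 1 → M ≤ EA R m h b b + L * EB R m h b b)
    (hK1 : K ≤ C1 ^ (m + 2) / (4 * R1))
    (hK2 : K * (C2 ^ (m + 2) * (R1 ^ 3 / 3)) < (L * (C1 ^ m * (R1 ^ 3 / 12))) ^ 2) :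
    ∃ ε > 0, ∀ a, LipR R a → a R = 0 → a 0 = 1 →
      EA R m h a a + L * EB R m h a a < M + ε → K ≤ EA R m h a a := by
  have hC2 : 0 < C2 := hC1.trans hC12
  set P := C2 ^ (m + 2) * (R1 ^ 3 / 3) with hP
  set g := L * (C1 ^ m * (R1 ^ 3 / 12)) with hg
  have hPpos : 0 < P := by positivity
  have hgpos : 0 < g := by positivity
  have hbl := bump_lip (R1 := R1) hR hR1
  set q := EA R m h (bump R1) (bump R1) + L * EB R m h (bump R1) (bump R1) + 1 with hq
  have hEb := EA_nonneg (m := m) hR hp (bump R1)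
  have hBb := mul_nonneg hL.le (EB_nonneg (m := m) hR hp (bump R1))
  have hqpos : 0 < q := by linarith
  set β := (g ^ 2 - K * P) / (2 * g) with hβ
  have hβpos : 0 < β := div_pos (by linarith) (by linarith)
  refine ⟨β ^ 2 / q, by positivity, fun a ha haR ha0 hF => ?_⟩
  by_contra! hE
  have har : ∀ r ∈ Icc 0 R1, 1 / 2 ≤ a r := by
    intro r hr
    by_contra! hlt
    have := case1 (m := m) hR hc hp hC1 hR1 hR1R hlb ha ha0 hr hlt.le
    linarith
  have hY := EB_bump (m := m) hR hc hC1 hR1 hR1R hlb ha har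
  have hY' : g ≤ L * EB R m h a (bump R1) := mul_le_mul_of_nonneg_left hY hL.le
  have hEP := EA_bump (m := m) hR hc hp hR1 hR1R hub
  have hX := EA_nonneg (m := m) hR hp (fun x => a x - (-(g / P)) * bump R1 x)
  rw [EA_sub hR hc ha hbl] at hX
  set E := EA R m h a a
  set X := EA R m h a (bump R1)
  set Y := EB R m h a (bump R1)
  set Ep := EA R m h (bump R1) (bump R1)
  have hX2 : 0 ≤ E * P + 2 * g * X + g ^ 2 := by
    have h1 : (g / P) ^ 2 * Ep ≤ (g / P) ^ 2 * P := mul_le_mul_of_nonneg_left hEP (sq_nonneg _)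
    have h2 : 0 ≤ (E + 2 * (g / P) * X + (g / P) ^ 2 * P) * P :=
      mul_nonneg (by nlinarith) hPpos.le
    have h3 : (E + 2 * (g / P) * X + (g / P) ^ 2 * P) * P = E * P + 2 * g * X + g ^ 2 := by
      field_simp
    linarith
  have hB : β ≤ X + L * Y := by
    rw [hβ, div_le_iff₀ (by positivity)]
    nlinarith [mul_lt_mul_of_pos_right hE hPpos, mul_le_mul_of_nonneg_left hY' hgpos.le]
  have hb0 : bump R1 0 = 0 := by simp [bump]
  have hbR : bump R1 R = 0 := bump_eq0 hR1 hR1R.le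
  have hvar := hM (fun x => a x - β / q * bump R1 x) (ha.sub_smul hbl _)
    (by simp [haR, hbR]) (by simp [ha0, hb0])
  rw [EA_sub hR hc ha hbl, EB_sub hR hc ha hbl] at hvar
  set s := β / q with hs
  have hspos : 0 < s := by positivity
  have e1 : β ^ 2 / q = s * β := by rw [hs]; ring
  have e2 : s ^ 2 * q = s * β := by rw [hs]; field_simp
  rw [e1] at hF
  have e3 : s * β ≤ s * (X + L * Y) := mul_le_mul_of_nonneg_left hB hspos.le
  have e4 : s ^ 2 * q = s ^ 2 * Ep + L * (s ^ 2 * EB R m h (bump R1) (bump R1)) + s ^ 2 := by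
    rw [hq]; ring
  have e5 : 0 < s ^ 2 := by positivity
  nlinarith

lemma sphereEig_nonneg (m k : ℕ) : 0 ≤ sphereEig (m + 3) k := by
  unfold sphereEig
  apply mul_nonneg (Nat.cast_nonneg _)
  push_cast
  linarith [Nat.cast_nonneg (α := ℝ) m, Nat.cast_nonneg (α := ℝ) k]

lemma steklov_le (hR : 0 < R) (hc : ContinuousOn h (Icc 0 R)) (hp : ∀ x ∈ Icc 0 R, 0 ≤ h x)
    (h0 : 0 < h 0) (k : ℕ) {b : ℝ → ℝ} (hb : LipR R b) (hbR : b R = 0) (hb0 : b 0 = 1) :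
    steklov R (m + 3) k h * h 0 ^ (m + 2)
      ≤ EA R m h b b + sphereEig (m + 3) k * EB R m h b b := by
  rw [← le_div_iff₀ (by positivity)]
  have e := rayleigh_eq (m := m) hR hc hb (sphereEig (m + 3) k)
  rw [hb0, one_pow, one_mul] at e
  rw [← e]
  apply csInf_le
  · refine ⟨0, ?_⟩
    rintro v ⟨a, ha, rfl⟩
    rw [rayleigh_eq hR hc ha.1]
    have := mul_nonneg (sphereEig_nonneg m k) (EB_nonneg (m := m) hR hp a)
    have := EA_nonneg (m := m) hR hp a
    positivity
  · exact ⟨b, ⟨hb, hbR, by rw [hb0]; exact one_ne_zero⟩, rfl⟩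

lemma lin_lip (hR : 0 < R) : LipR R (fun x => 1 - R⁻¹ * x) := by
  have h1 : LipR R (fun _ => (1:ℝ)) := ⟨0, LipschitzOnWith.of_dist_le_mul fun x _ y _ => by simp⟩
  have h2 : LipR R (fun x => x) := ⟨1, LipschitzOnWith.of_dist_le_mul fun x _ y _ => by simp⟩
  exact h1.sub_smul h2 _

lemma steklov_approx (hR : 0 < R) (hc : ContinuousOn h (Icc 0 R))
    (h0 : 0 < h 0) (k : ℕ) {ε : ℝ} (hε : 0 < ε) :
    ∃ a, LipR R a ∧ a R = 0 ∧ a 0 = 1 ∧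
      EA R m h a a + sphereEig (m + 3) k * EB R m h a a
        < steklov R (m + 3) k h * h 0 ^ (m + 2) + ε := by
  have hH : 0 < h 0 ^ (m + 2) := by positivity
  have hne : { v : ℝ | ∃ a : ℝ → ℝ, IsAdmissible R a ∧
      v = rayleighQ R (m + 3) (sphereEig (m + 3) k) h a }.Nonempty :=
    ⟨_, _, ⟨lin_lip hR, by simp [hR.ne'], by simp⟩, rfl⟩
  have hlt : steklov R (m + 3) k h < steklov R (m + 3) k h + ε / h 0 ^ (m + 2) := by
    have : 0 < ε / h 0 ^ (m + 2) := by positivity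
    linarith
  obtain ⟨v, ⟨a, ha, rfl⟩, hv⟩ := exists_lt_of_csInf_lt hne hlt
  obtain ⟨hal, haR, ha0⟩ := ha
  rw [rayleigh_eq hR hc hal] at hv
  have hz : LipR R (fun _ => (0:ℝ)) := ⟨0, LipschitzOnWith.of_dist_le_mul fun x _ y _ => by simp⟩
  have hbl := hz.sub_smul hal (-(a 0)⁻¹)
  refine ⟨_, hbl, by simp [haR], by simp [ha0], ?_⟩
  rw [EA_sub hR hc hz hal, EB_sub hR hc hz hal]
  have z1 : ∀ u, EA R m h (fun _ => (0:ℝ)) u = 0 := fun u => by simp [EA]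
  have z2 : ∀ u, EB R m h (fun _ => (0:ℝ)) u = 0 := fun u => by simp [EB]
  rw [z1, z1, z2, z2]
  have ha2 : 0 < a 0 ^ 2 := by positivity
  rw [div_lt_iff₀ (by positivity)] at hv
  have e1 : (steklov R (m + 3) k h + ε / h 0 ^ (m + 2)) * (a 0 ^ 2 * h 0 ^ (m + 2))
      = (steklov R (m + 3) k h * h 0 ^ (m + 2) + ε) * a 0 ^ 2 := by
    field_simp
  rw [e1, ← div_lt_iff₀ ha2] at hv
  refine lt_of_eq_of_lt ?_ hv
  field_simp
  ring

lemma steklov_ub (hR : 0 < R) (hc : ContinuousOn h (Icc 0 R)) (hp : ∀ x ∈ Icc 0 R, 0 ≤ h x)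
    (h0 : 0 < h 0) (k : ℕ) {C2 R1 : ℝ} (hR1 : 0 < R1) (hR1R : R1 < R)
    (hub : ∀ r ∈ Set.Icc (0:ℝ) R, h r ≤ C2) :
    steklov R (m + 3) k h * h 0 ^ (m + 2)
      ≤ C2 ^ m * (R * sphereEig (m + 3) k + C2 ^ 2 / (R - R1)) := by
  have hl := lin_lip hR
  have hC2 : 0 < C2 := h0.trans_le (hub 0 ⟨le_rfl, hR.le⟩)
  refine (steklov_le (m := m) hR hc hp h0 k hl (by simp [hR.ne']) (by simp)).trans ?_
  have hd : ∀ x : ℝ, deriv (fun x => 1 - R⁻¹ * x) x = -R⁻¹ := by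
    intro x
    have := (((hasDerivAt_id x).const_mul R⁻¹).const_sub 1).deriv
    simpa using this
  have hA : EA R m h (fun x => 1 - R⁻¹ * x) (fun x => 1 - R⁻¹ * x) ≤ C2 ^ m * (C2 ^ 2 / (R - R1)) := by
    have h1 : EA R m h (fun x => 1 - R⁻¹ * x) (fun x => 1 - R⁻¹ * x)
        ≤ ∫ r in (0:ℝ)..R, R⁻¹ * R⁻¹ * C2 ^ (m + 2) := by
      apply intervalIntegral.integral_mono_on hR.le (ii_EA hR hc hl hl) intervalIntegrable_const
      intro x hx
      rw [hd]
      have : h x ^ (m + 2) ≤ C2 ^ (m + 2) := pow_le_pow_left₀ (hp x hx) (hub x hx) _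
      rw [neg_mul_neg]
      exact mul_le_mul_of_nonneg_left this (by positivity)
    refine h1.trans ?_
    rw [intervalIntegral.integral_const, smul_eq_mul, sub_zero]
    have h2 : R⁻¹ ≤ (R - R1)⁻¹ := inv_anti₀ (by linarith) (by linarith)
    have h3 : R * (R⁻¹ * R⁻¹ * C2 ^ (m + 2)) = C2 ^ m * (C2 ^ 2 * R⁻¹) := by
      field_simp
      ring
    rw [h3, div_eq_mul_inv]
    gcongr
  have hB : EB R m h (fun x => 1 - R⁻¹ * x) (fun x => 1 - R⁻¹ * x) ≤ R * C2 ^ m := by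
    have h1 : EB R m h (fun x => 1 - R⁻¹ * x) (fun x => 1 - R⁻¹ * x)
        ≤ ∫ r in (0:ℝ)..R, C2 ^ m := by
      apply intervalIntegral.integral_mono_on hR.le (ii_EB hR hc hl hl) intervalIntegrable_const
      intro x hx
      have h2 : h x ^ m ≤ C2 ^ m := pow_le_pow_left₀ (hp x hx) (hub x hx) _
      have h3 : 0 ≤ R⁻¹ * x := mul_nonneg (by positivity) hx.1
      have h4 : R⁻¹ * x ≤ 1 := by
        rw [inv_mul_le_iff₀ hR]; linarith [hx.2]
      have h5 : (1 - R⁻¹ * x) * (1 - R⁻¹ * x) ≤ 1 := by nlinarith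
      calc _ ≤ 1 * C2 ^ m := mul_le_mul h5 h2 (pow_nonneg (hp x hx) _) zero_le_one
        _ = _ := one_mul _
    refine h1.trans (le_of_eq ?_)
    rw [intervalIntegral.integral_const, smul_eq_mul, sub_zero]
  have := mul_le_mul_of_nonneg_left hB (sphereEig_nonneg m k)
  nlinarith

end

/-- Final arithmetic. -/
lemma ratio_bound {s s' H L L' K T γ : ℝ} (hH : 0 < H) (hL : 0 < L) (hLL : L < L') (hK : 0 < K)
    (hs : K ≤ s * H) (hsT : s * H ≤ T) (hs' : s' * H ≤ L' / L * (s * H) - (L' - L) / L * K)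
    (hγ : γ * T * L ≤ (L' - L) * K) (hγ0 : 0 < γ) : s' / s ≤ L' / L - γ := by
  have hsH : 0 < s * H := hK.trans_le hs
  have hspos : 0 < s := pos_of_mul_pos_left hsH hH.le
  have e : s' / s = (s' * H) / (s * H) := by field_simp
  rw [e, div_le_iff₀ hsH]
  have h1 : γ * (s * H) ≤ (L' - L) / L * K := by
    rw [div_mul_eq_mul_div, le_div_iff₀ hL]
    have : γ * (s * H) * L ≤ γ * T * L := by gcongr
    linarith
  linarith

theorem stmt_3 (n : ℕ) (hn : 3 ≤ n) (R : ℝ) (hR : 0 < R) (h : ℝ → ℝ)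
    (hH : SatisfiesH R h) (k : ℕ) (hk : 1 ≤ k)
    (C1 C2 R1 : ℝ) (hC1 : 0 < C1) (hC12 : C1 < C2) (hR1 : 0 < R1) (hR1R : R1 < R)
    (hub : ∀ r ∈ Set.Icc (0:ℝ) R, h r ≤ C2)
    (hlb : ∀ r ∈ Set.Icc (0:ℝ) R1, C1 ≤ h r) :
    steklov R n (k + 1) h / steklov R n k h ≤
      sphereEig n (k + 1) / sphereEig n k -
        min
          ((1 / (4 * R1)) * (C1 ^ (2 * (n - 1)) / C2 ^ (2 * (n - 2))) *
            (sphereEig n (k + 1) - sphereEig n k) *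
            (R * (sphereEig n k) ^ 2 + C2 ^ 2 * sphereEig n k / (R - R1))⁻¹)
          ((C1 ^ (4 * (n - 2)) / C2 ^ (2 * (2 * n - 3))) * (R1 ^ 3 / 128) *
            (sphereEig n (k + 1) - sphereEig n k) *
            (R + C2 ^ 2 / ((R - R1) * sphereEig n k))⁻¹) := by
  obtain ⟨m, rfl⟩ : ∃ m, n = m + 3 := ⟨n - 3, by omega⟩
  obtain ⟨hsm, hpos, hhR, -, -⟩ := hH
  have hc : ContinuousOn h (Icc 0 R) := hsm.continuousOn
  have hp : ∀ x ∈ Icc 0 R, 0 ≤ h x := by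
    intro x hx
    rcases eq_or_lt_of_le hx.2 with h1 | h1
    · rw [h1, hhR]
    · exact (hpos x ⟨hx.1, h1⟩).le
  have h0 : 0 < h 0 := hpos 0 ⟨le_rfl, hR⟩
  have hC2 : 0 < C2 := hC1.trans hC12
  have hL : 0 < sphereEig (m + 3) k := by
    have : (1:ℝ) ≤ k := by exact_mod_cast hk
    unfold sphereEig
    push_cast
    have hm := Nat.cast_nonneg (α := ℝ) m
    apply mul_pos <;> linarith
  have hLL : sphereEig (m + 3) k < sphereEig (m + 3) (k + 1) := by
    have : (1:ℝ) ≤ k := by exact_mod_cast hk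
    unfold sphereEig
    push_cast
    have hm := Nat.cast_nonneg (α := ℝ) m
    nlinarith
  have hub' := steklov_ub (m := m) hR hc hp h0 k hR1 hR1R hub
  have hM := fun b hb hbR hb0 => steklov_le (m := m) hR hc hp h0 k (b := b) hb hbR hb0
  have hM' := fun b hb hbR hb0 => steklov_le (m := m) hR hc hp h0 (k + 1) (b := b) hb hbR hb0
  have hap := fun ε (hε : 0 < ε) => steklov_approx (m := m) hR hc h0 k hε
  have i1 : 2 * (m + 3 - 1) = 2 * m + 4 := by omega
  have i2 : 2 * (m + 3 - 2) = 2 * m + 2 := by omega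
  have i3 : 4 * (m + 3 - 2) = 4 * m + 4 := by omega
  have i4 : 2 * (2 * (m + 3) - 3) = 4 * m + 6 := by omega
  rw [i1, i2, i3, i4]
  set L := sphereEig (m + 3) k
  set L' := sphereEig (m + 3) (k + 1)
  have hRR : 0 < R - R1 := by linarith
  have hD : 0 < L' - L := by linarith
  set S := R * L + C2 ^ 2 / (R - R1) with hS
  have hSpos : 0 < S := by positivity
  have s1 : R * L ^ 2 + C2 ^ 2 * L / (R - R1) = L * S := by rw [hS]; field_simp
  have s2 : R + C2 ^ 2 / ((R - R1) * L) = S / L := by rw [hS]; field_simp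
  rw [s1, s2]
  set γ := min (1 / (4 * R1) * (C1 ^ (2 * m + 4) / C2 ^ (2 * m + 2)) * (L' - L) * (L * S)⁻¹)
    (C1 ^ (4 * m + 4) / C2 ^ (4 * m + 6) * (R1 ^ 3 / 128) * (L' - L) * (S / L)⁻¹) with hγ
  have hγ0 : 0 < γ := lt_min (by positivity) (by positivity)
  set T := C2 ^ m * S with hT
  have hTpos : 0 < T := by positivity
  set K := γ * T * L / (L' - L) with hK
  have hKpos : 0 < K := by positivity
  have hθ : ∀ j, C1 ^ j ≤ C2 ^ j := fun j => pow_le_pow_left₀ hC1.le hC12.le j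
  have hK1 : K ≤ C1 ^ (m + 2) / (4 * R1) := by
    calc K ≤ (1 / (4 * R1) * (C1 ^ (2 * m + 4) / C2 ^ (2 * m + 2)) * (L' - L) * (L * S)⁻¹)
          * T * L / (L' - L) := by
            rw [hK]
            have := min_le_left (1 / (4 * R1) * (C1 ^ (2 * m + 4) / C2 ^ (2 * m + 2)) * (L' - L) * (L * S)⁻¹)
              (C1 ^ (4 * m + 4) / C2 ^ (4 * m + 6) * (R1 ^ 3 / 128) * (L' - L) * (S / L)⁻¹)
            gcongr
      _ = C1 ^ (m + 2) / (4 * R1) * (C1 ^ (m + 2) / C2 ^ (m + 2)) := by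
            rw [hT]
            field_simp
            ring
      _ ≤ C1 ^ (m + 2) / (4 * R1) * 1 := by
            gcongr
            exact div_le_one_of_le₀ (hθ _) (by positivity)
      _ = _ := mul_one _
  have hK2 : K ≤ L ^ 2 * C1 ^ (2 * m) * (R1 ^ 3 / 128) / C2 ^ (m + 2) := by
    calc K ≤ (C1 ^ (4 * m + 4) / C2 ^ (4 * m + 6) * (R1 ^ 3 / 128) * (L' - L) * (S / L)⁻¹)
          * T * L / (L' - L) := by
            rw [hK]
            have := min_le_right (1 / (4 * R1) * (C1 ^ (2 * m + 4) / C2 ^ (2 * m + 2)) * (L' - L) * (L * S)⁻¹)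
              (C1 ^ (4 * m + 4) / C2 ^ (4 * m + 6) * (R1 ^ 3 / 128) * (L' - L) * (S / L)⁻¹)
            gcongr
      _ = L ^ 2 * C1 ^ (2 * m) * (R1 ^ 3 / 128) / C2 ^ (m + 2) * (C1 ^ (2 * m + 4) / C2 ^ (2 * m + 4)) := by
            rw [hT]
            field_simp
            ring
      _ ≤ L ^ 2 * C1 ^ (2 * m) * (R1 ^ 3 / 128) / C2 ^ (m + 2) * 1 := by
            gcongr
            exact div_le_one_of_le₀ (hθ _) (by positivity)
      _ = _ := mul_one _
  have hK3 : K * (C2 ^ (m + 2) * (R1 ^ 3 / 3)) < (L * (C1 ^ m * (R1 ^ 3 / 12))) ^ 2 := by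
    rw [le_div_iff₀ (by positivity)] at hK2
    have h1 := mul_le_mul_of_nonneg_right hK2 (show (0:ℝ) ≤ R1 ^ 3 / 3 by positivity)
    have h2 : (L * (C1 ^ m * (R1 ^ 3 / 12))) ^ 2 = L ^ 2 * C1 ^ (2 * m) * R1 ^ 6 / 144 := by ring
    have h3 : 0 < L ^ 2 * C1 ^ (2 * m) * R1 ^ 6 := by positivity
    rw [h2]
    nlinarith
  obtain ⟨ε, hε, hkey⟩ := key (m := m) hR hc hp hC1 hC12 hR1 hR1R hub hL hlb hM hK1 hK3
  set M := steklov R (m + 3) k h * h 0 ^ (m + 2)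
  have hget : ∀ δ, 0 < δ → δ ≤ ε → ∃ A B, K ≤ A ∧ 0 ≤ B ∧ A + L * B < M + δ ∧
      steklov R (m + 3) (k + 1) h * h 0 ^ (m + 2) ≤ A + L' * B := by
    intro δ hδ hδε
    obtain ⟨a, ha, haR, ha0, hF⟩ := hap δ hδ
    exact ⟨_, _, hkey a ha haR ha0 (by linarith), EB_nonneg hR hp a, hF, hM' a ha haR ha0⟩
  refine ratio_bound (H := h 0 ^ (m + 2)) (K := K) (T := T) (by positivity) hL hLL hKpos ?_ hub' ?_ ?_ hγ0
  · apply le_of_forall_pos_le_add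
    intro δ hδ
    obtain ⟨A, B, hA, hB, h1, -⟩ := hget (min δ ε) (lt_min hδ hε) (min_le_right _ _)
    have := min_le_left δ ε
    have := mul_nonneg hL.le hB
    change K ≤ M + δ
    linarith
  · apply le_of_forall_pos_le_add
    intro δ hδ
    have hL' : 0 < L' := hL.trans hLL
    obtain ⟨A, B, hA, hB, h1, h2⟩ := hget (min (δ * L / L') ε) (lt_min (by positivity) hε)
      (min_le_right _ _)
    have h3 := min_le_left (δ * L / L') ε
    refine h2.trans ?_
    change A + L' * B ≤ L' / L * M - (L' - L) / L * K + δ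
    have e1 : A + L' * B = L' / L * (A + L * B) - (L' - L) / L * A := by field_simp; ring
    have e2 : L' / L * (A + L * B) ≤ L' / L * (M + δ * L / L') :=
      mul_le_mul_of_nonneg_left (by linarith) (by positivity)
    have e3 : L' / L * (M + δ * L / L') = L' / L * M + δ := by field_simp
    have e4 : (L' - L) / L * K ≤ (L' - L) / L * A :=
      mul_le_mul_of_nonneg_left hA (by positivity)
    linarith
  · rw [hK, mul_div_cancel₀ _ hD.ne']
end

section
/- Let n = 3, let h₀ > 0, and let k ≥ 0 be an integer. Then the supremum, over all functions h satisfying hypotheses (H) with h(0) = h₀, of the Steklov spectral gap σ_(k+1)(g_h) − σ_(k)(g_h) equals R(λ_(k+1) − λ_(k))/h₀²; that is, σ_(k+1)(g_h) − σ_(k)(g_h) ≤ R(λ_(k+1) − λ_(k))/h₀² for every such h, and for every ε > 0 there exists h satisfying (H) with h(0) = h₀ and σ_(k+1)(g_h) − σ_(k)(g_h) > R(λ_(k+1) − λ_(k))/h₀² − ε. -/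
open MeasureTheory Set

noncomputable def EE (R : ℝ) (h a : ℝ → ℝ) : ℝ := ∫ r in (0:ℝ)..R, (deriv a r) ^ 2 * h r ^ 2

noncomputable def AA (R : ℝ) (a : ℝ → ℝ) : ℝ := ∫ r in (0:ℝ)..R, (a r) ^ 2

lemma intE {R : ℝ} (hR : 0 < R) {h a : ℝ → ℝ} (hh : ContinuousOn h (Icc 0 R)) {K : NNReal}
    (ha : LipschitzOnWith K a (Icc 0 R)) :
    IntervalIntegrable (fun r => (deriv a r) ^ 2 * h r ^ 2) volume 0 R := by
  rw [intervalIntegrable_iff_integrableOn_Ioo_of_le hR.le]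
  obtain ⟨C, hC⟩ := isCompact_Icc.exists_bound_of_continuousOn hh
  refine Integrable.of_bound (μ := volume.restrict (Ioo 0 R)) ?_ ((K:ℝ) ^ 2 * C ^ 2) ?_
  · refine AEStronglyMeasurable.mul ?_ ?_
    · exact ((measurable_deriv a).pow_const 2).aestronglyMeasurable
    · exact ((hh.mono Ioo_subset_Icc_self).pow 2).aestronglyMeasurable measurableSet_Ioo
  · refine (ae_restrict_iff' measurableSet_Ioo).2 (Filter.Eventually.of_forall fun r hr => ?_)
    have h1 : ‖deriv a r‖ ≤ K := norm_deriv_le_of_lipschitzOn (Icc_mem_nhds hr.1 hr.2) ha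
    have h2 := hC r (Ioo_subset_Icc_self hr)
    rw [norm_mul, norm_pow, norm_pow]
    gcongr

lemma intA {R : ℝ} (hR : 0 < R) {a : ℝ → ℝ} {K : NNReal}
    (ha : LipschitzOnWith K a (Icc 0 R)) :
    IntervalIntegrable (fun r => (a r) ^ 2) volume 0 R := by
  apply ContinuousOn.intervalIntegrable
  rw [uIcc_of_le hR.le]
  exact ha.continuousOn.pow 2

lemma EE_nonneg {R : ℝ} (hR : 0 < R) (h a : ℝ → ℝ) : 0 ≤ EE R h a :=
  intervalIntegral.integral_nonneg hR.le fun r _ => by positivity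

lemma AA_nonneg {R : ℝ} (hR : 0 < R) (a : ℝ → ℝ) : 0 ≤ AA R a :=
  intervalIntegral.integral_nonneg hR.le fun r _ => by positivity

lemma ray_eq {R : ℝ} (hR : 0 < R) {h a : ℝ → ℝ} (hh : ContinuousOn h (Icc 0 R))
    (ha : IsAdmissible R a) (l : ℝ) :
    rayleighQ R 3 l h a = (EE R h a + l * AA R a) / ((a 0) ^ 2 * h 0 ^ 2) := by
  obtain ⟨⟨K, hK⟩, -, -⟩ := ha
  unfold rayleighQ EE AA
  rw [← intervalIntegral.integral_const_mul,
    ← intervalIntegral.integral_add (intE hR hh hK) ((intA hR hK).const_mul l)]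
  have e1 : (((3:ℕ):ℤ) - 1) = ((2:ℕ):ℤ) := by norm_num
  have e2 : (((3:ℕ):ℤ) - 3) = 0 := by norm_num
  simp only [e1, e2, zpow_natCast, zpow_zero, mul_one]

lemma eig_nonneg (k : ℕ) : 0 ≤ sphereEig 3 k := by
  unfold sphereEig
  have : (0:ℝ) ≤ k := Nat.cast_nonneg k
  push_cast
  apply mul_nonneg this; linarith

lemma eig_diff (k : ℕ) : 0 ≤ sphereEig 3 (k+1) - sphereEig 3 k := by
  unfold sphereEig
  have : (0:ℝ) ≤ k := Nat.cast_nonneg k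
  push_cast
  nlinarith

lemma stek_le {R : ℝ} (hR : 0 < R) {h a : ℝ → ℝ} (hh : ContinuousOn h (Icc 0 R))
    (ha : IsAdmissible R a) (k : ℕ) : steklov R 3 k h ≤ rayleighQ R 3 (sphereEig 3 k) h a := by
  refine csInf_le ⟨0, ?_⟩ ⟨a, ha, rfl⟩
  rintro v ⟨b, hb, rfl⟩
  rw [ray_eq hR hh hb]
  have := EE_nonneg hR h b
  have := AA_nonneg hR b
  have := eig_nonneg k
  positivity

lemma stek_ge {R : ℝ} (hR : 0 < R) {h : ℝ → ℝ} (k : ℕ) (c : ℝ)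
    (H : ∀ a, IsAdmissible R a → c ≤ rayleighQ R 3 (sphereEig 3 k) h a) :
    c ≤ steklov R 3 k h := by
  refine le_csInf ⟨_, fun r => R - r, ⟨⟨1, ?_⟩, by simp, by simpa using hR.ne'⟩, rfl⟩ ?_
  · refine LipschitzOnWith.of_dist_le_mul fun x _ y _ => ?_
    have e : R - x - (R - y) = -(x - y) := by ring
    rw [Real.dist_eq, Real.dist_eq, e, abs_neg]; simp
  · rintro v ⟨b, hb, rfl⟩
    exact H b hb

/-- truncation -/
lemma trunc {R : ℝ} (hR : 0 < R) {h a : ℝ → ℝ} (hh : ContinuousOn h (Icc 0 R))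
    (ha : IsAdmissible R a) :
    ∃ b, IsAdmissible R b ∧ b 0 = a 0 ∧ EE R h b ≤ EE R h a ∧ AA R b ≤ AA R a ∧
      AA R b ≤ R * (a 0) ^ 2 := by
  have ha' := ha
  obtain ⟨⟨K, hK⟩, haR, ha0⟩ := ha
  set c := |a 0| with hc
  have hc0 : 0 ≤ c := abs_nonneg _
  set b : ℝ → ℝ := fun r => max (-c) (min c (a r)) with hb
  have hba : ∀ x y, |b x - b y| ≤ |a x - a y| := by
    intro x y
    refine (abs_max_sub_max_le_max _ _ _ _).trans ?_
    simp only [sub_self, abs_zero]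
    refine max_le (abs_nonneg _) ((abs_min_sub_min_le_max _ _ _ _).trans ?_)
    simp
  have hb1 : ∀ x, |b x| ≤ |a x| := by
    intro x
    simp only [hb]
    rcases le_total c (a x) with h1 | h1
    · rw [min_eq_left h1, max_eq_right (by linarith), abs_of_nonneg hc0]
      exact h1.trans (le_abs_self _)
    · rw [min_eq_right h1]
      rcases le_total (-c) (a x) with h2 | h2
      · rw [max_eq_right h2]
      · rw [max_eq_left h2, abs_neg, abs_of_nonneg hc0]
        have := neg_abs_le (a x); linarith
  have hb2 : ∀ x, |b x| ≤ c := by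
    intro x
    exact abs_le.2 ⟨le_max_left _ _, max_le (by linarith) (min_le_left _ _)⟩
  have hb0 : b 0 = a 0 := by
    simp only [hb]
    rw [min_eq_right (le_abs_self _), max_eq_right (neg_abs_le _)]
  have hbK : LipschitzOnWith K b (Icc 0 R) := by
    refine LipschitzOnWith.of_dist_le_mul fun x hx y hy => ?_
    exact (hba x y).trans (hK.dist_le_mul x hx y hy)
  have hbad : IsAdmissible R b := ⟨⟨K, hbK⟩, by
    have := hb1 R; rw [haR, abs_zero] at this; exact abs_nonpos_iff.1 this, by rwa [hb0]⟩
  refine ⟨b, hbad, hb0, ?_, ?_, ?_⟩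
  · apply intervalIntegral.integral_mono_ae_restrict hR.le (intE hR hh hbK) (intE hR hh hK)
    rw [← restrict_Ioo_eq_restrict_Icc]
    refine (ae_restrict_iff' measurableSet_Ioo).2 ?_
    filter_upwards [hK.ae_differentiableWithinAt_of_mem_real] with r hr hrr
    have hd : DifferentiableAt ℝ a r :=
      (hr (Ioo_subset_Icc_self hrr)).differentiableAt (Icc_mem_nhds hrr.1 hrr.2)
    have key : |deriv b r| ≤ |deriv a r| := by
      by_cases hbd : DifferentiableAt ℝ b r
      · have t1 := (hasDerivAt_iff_tendsto_slope.1 hbd.hasDerivAt).abs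
        have t2 := (hasDerivAt_iff_tendsto_slope.1 hd.hasDerivAt).abs
        refine le_of_tendsto_of_tendsto t1 t2 (Filter.Eventually.of_forall fun y => ?_)
        simp only [slope_def_field, abs_div]
        exact div_le_div_of_nonneg_right (hba y r) (abs_nonneg _)
      · rw [deriv_zero_of_not_differentiableAt hbd, abs_zero]; exact abs_nonneg _
    exact mul_le_mul_of_nonneg_right (sq_le_sq.2 key) (sq_nonneg _)
  · exact intervalIntegral.integral_mono_on hR.le (intA hR hbK) (intA hR hK)
      fun x _ => sq_le_sq.2 (hb1 x)
  · have := intervalIntegral.integral_mono_on (g := fun _ => (a 0) ^ 2) hR.le (intA hR hbK) (by simp)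
      fun x _ => sq_le_sq.2 (hb2 x)
    simpa [AA] using this

lemma upper {R : ℝ} (hR : 0 < R) {h0 : ℝ} (hh0 : 0 < h0) (k : ℕ) {h : ℝ → ℝ}
    (hh : ContinuousOn h (Icc 0 R)) (h00 : h 0 = h0) :
    steklov R 3 (k + 1) h - steklov R 3 k h ≤
        R * (sphereEig 3 (k + 1) - sphereEig 3 k) / h0 ^ 2 := by
  rw [sub_le_comm]
  apply stek_ge hR
  intro a ha
  obtain ⟨b, hb, hb0, h1, h2, h3⟩ := trunc hR hh ha
  have h4 := stek_le hR hh hb (k+1)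
  rw [ray_eq hR hh ha]
  rw [ray_eq hR hh hb, hb0] at h4
  rw [sub_le_iff_le_add]
  refine h4.trans ?_
  rw [h00]
  have hp : 0 < a 0 ^ 2 := by have := ha.2.2; positivity
  have : R * (sphereEig 3 (k + 1) - sphereEig 3 k) / h0 ^ 2 =
    R * a 0 ^ 2 * (sphereEig 3 (k + 1) - sphereEig 3 k) / (a 0 ^ 2 * h0 ^ 2) := by
    have := ha.2.2
    field_simp
  rw [this, ← add_div]
  refine div_le_div_of_nonneg_right ?_ (by positivity)
  have := mul_le_mul_of_nonneg_left h2 (eig_nonneg k)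
  have := mul_le_mul_of_nonneg_left h3 (eig_diff k)
  linarith

/-- uniform upper bound for the eigenvalue -/
lemma stek_bound {R : ℝ} (hR : 0 < R) {h0 : ℝ} (hh0 : 0 < h0) (k : ℕ) {h : ℝ → ℝ}
    (hh : ContinuousOn h (Icc 0 R)) (h00 : h 0 = h0) {K : ℝ}
    (hK : ∀ r ∈ Icc 0 R, |h r| ≤ K * (R - r)) :
    steklov R 3 k h ≤ (1 + sphereEig 3 k * R) / h0 ^ 2 := by
  have hKK : 0 ≤ K ^ 2 := sq_nonneg K
  obtain ⟨d, hd0, hdR, hdK⟩ : ∃ d, 0 < d ∧ d ≤ R ∧ K ^ 2 * d ≤ 1 := by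
    refine ⟨min R (1 / (K ^ 2 + 1)), by positivity, min_le_left _ _, ?_⟩
    calc K ^ 2 * min R (1 / (K ^ 2 + 1)) ≤ K ^ 2 * (1 / (K ^ 2 + 1)) := by
          gcongr; exact min_le_right _ _
      _ ≤ 1 := by rw [mul_one_div, div_le_one (by positivity)]; linarith
  set b : ℝ → ℝ := fun r => min 1 ((R - r) / d) with hb
  have hlip : LipschitzWith (Real.toNNReal (1 / d)) b := by
    refine LipschitzWith.of_dist_le_mul fun x y => ?_
    rw [Real.coe_toNNReal _ (by positivity), Real.dist_eq, Real.dist_eq]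
    refine (abs_min_sub_min_le_max _ _ _ _).trans ?_
    rw [← sub_div, abs_div, abs_of_pos hd0, sub_self, abs_zero]
    refine max_le (by positivity) ?_
    have : R - x - (R - y) = -(x - y) := by ring
    rw [this, abs_neg]
    exact le_of_eq (by ring)
  have hb0 : b 0 = 1 := by
    simp only [hb]; rw [min_eq_left]; rw [le_div_iff₀ hd0]; linarith
  have hbad : IsAdmissible R b := by
    refine ⟨⟨_, hlip.lipschitzOnWith⟩, by simp [hb], by rw [hb0]; exact one_ne_zero⟩
  refine (stek_le hR hh hbad k).trans ?_
  rw [ray_eq hR hh hbad, hb0, h00, one_pow, one_mul]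
  have hA : AA R b ≤ R := by
    have := intervalIntegral.integral_mono_on (g := fun _ => (1:ℝ)) hR.le
      (intA hR hlip.lipschitzOnWith) (by simp) (fun x hx => ?_)
    · simpa [AA] using this
    · have h1 : b x ≤ 1 := min_le_left _ _
      have h2 : 0 ≤ b x := le_min zero_le_one (div_nonneg (by linarith [hx.2]) hd0.le)
      exact pow_le_one₀ h2 h1
  have hE : EE R h b ≤ 1 := by
    have hi := intE hR hh (hlip.lipschitzOnWith (s := Icc 0 R))
    have hm : R - d ∈ uIcc 0 R := by rw [uIcc_of_le hR.le]; constructor <;> linarith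
    have i1 := hi.mono_set (uIcc_subset_uIcc_left hm)
    have i2 := hi.mono_set (uIcc_subset_uIcc_right hm)
    unfold EE
    rw [← intervalIntegral.integral_add_adjacent_intervals i1 i2]
    have e1 : (∫ r in (0:ℝ)..(R-d), (deriv b r) ^ 2 * h r ^ 2) ≤ ∫ r in (0:ℝ)..(R-d), (0:ℝ) := by
      refine intervalIntegral.integral_mono_on_of_le_Ioo (by linarith) i1 (by simp) fun x hx => ?_
      have : b =ᶠ[nhds x] fun _ => (1:ℝ) := by
        filter_upwards [Iio_mem_nhds hx.2] with y hy
        have hy' : y < R - d := hy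
        simp only [hb]; rw [min_eq_left]; rw [le_div_iff₀ hd0]; linarith
      rw [this.deriv_eq]; simp
    have e2 : (∫ r in (R-d)..R, (deriv b r) ^ 2 * h r ^ 2) ≤ ∫ r in (R-d)..R, (K^2:ℝ) := by
      refine intervalIntegral.integral_mono_on_of_le_Ioo (by linarith) i2 (by simp) fun x hx => ?_
      have h1 : |deriv b x| ≤ 1 / d := by
        have := norm_deriv_le_of_lipschitz (x₀ := x) hlip
        rwa [Real.coe_toNNReal _ (by positivity)] at this
      have h2 := hK x ⟨by linarith [hx.1], hx.2.le⟩
      have h3 : |h x| ≤ |K| * d := by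
        refine h2.trans ?_
        have : R - x ≤ d := by linarith [hx.1]
        have h5 : 0 ≤ R - x := by linarith [hx.2]
        calc K * (R - x) ≤ |K| * (R - x) := by gcongr; exact le_abs_self K
          _ ≤ _ := by gcongr
      calc (deriv b x) ^ 2 * h x ^ 2 = |deriv b x| ^ 2 * |h x| ^ 2 := by rw [sq_abs, sq_abs]
        _ ≤ (1 / d) ^ 2 * (|K| * d) ^ 2 := by gcongr
        _ = K ^ 2 := by rw [mul_pow, sq_abs]; field_simp
    simp at e1 e2
    have : d * K ^ 2 = K ^ 2 * d := by ring
    linarith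
  have := mul_le_mul_of_nonneg_left hA (eig_nonneg k)
  gcongr

/-- functions with bounded energy stay close to their initial value -/
lemma close {R : ℝ} (hR : 0 < R) {h a : ℝ → ℝ} (hh : ContinuousOn h (Icc 0 R))
    (hpos : ∀ r ∈ Ico 0 R, 0 < h r)
    (ha : IsAdmissible R a) (ha0 : a 0 = 1) {δ τ C η : ℝ} (hδ : 0 < δ) (hδR : δ < R) (hτ : 0 < τ)
    (hC : EE R h a ≤ C) (hη : ∫ r in (0:ℝ)..(R-δ), (h r ^ 2)⁻¹ ≤ η) :
    (R - δ) * (1 - 2 * (τ * C + η / (4 * τ))) ≤ AA R a := by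
  obtain ⟨⟨K, hK⟩, haR, -⟩ := ha
  have hE := intE hR hh hK
  have hA := intA hR hK
  have hm : R - δ ∈ uIcc 0 R := by rw [uIcc_of_le hR.le]; constructor <;> linarith
  have hH : IntervalIntegrable (fun r => (h r ^ 2)⁻¹) volume 0 (R-δ) := by
    apply ContinuousOn.intervalIntegrable
    rw [uIcc_of_le (by linarith)]
    refine ContinuousOn.inv₀ ((hh.mono (Icc_subset_Icc_right (by linarith))).pow 2) ?_
    intro x hx
    have := hpos x ⟨hx.1, by linarith [hx.2]⟩
    positivity
  have pt : ∀ r ∈ Icc 0 (R - δ), |a r - 1| ≤ τ * C + η / (4 * τ) := by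
    intro r hr
    have hrR : r ≤ R := by linarith [hr.2]
    have hr1 : r ∈ uIcc 0 R := by rw [uIcc_of_le hR.le]; exact ⟨hr.1, hrR⟩
    have hr2 : r ∈ uIcc 0 (R-δ) := by rw [uIcc_of_le (by linarith)]; exact hr
    have hac : AbsolutelyContinuousOnInterval a 0 r := by
      apply LipschitzOnWith.absolutelyContinuousOnInterval (K := K)
      rw [uIcc_of_le hr.1]
      exact hK.mono (Icc_subset_Icc_right hrR)
    have hE' := hE.mono_set (uIcc_subset_uIcc_left hr1)
    have hH' := hH.mono_set (uIcc_subset_uIcc_left hr2)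
    have s1 : (∫ x in (0:ℝ)..r, (deriv a x) ^ 2 * h x ^ 2) ≤ C := by
      refine le_trans ?_ hC
      refine intervalIntegral.integral_mono_interval le_rfl hr.1 hrR ?_ hE
      exact Filter.Eventually.of_forall fun x => by simp only [Pi.zero_apply]; positivity
    have s2 : (∫ x in (0:ℝ)..r, (h x ^ 2)⁻¹) ≤ η := by
      refine le_trans ?_ hη
      refine intervalIntegral.integral_mono_interval le_rfl hr.1 hr.2 ?_ hH
      exact Filter.Eventually.of_forall fun x => by simp only [Pi.zero_apply]; positivity
    rw [← ha0, ← hac.integral_deriv_eq_sub]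
    refine (intervalIntegral.abs_integral_le_integral_abs hr.1).trans ?_
    have s3 : (∫ x in (0:ℝ)..r, |deriv a x|) ≤
        ∫ x in (0:ℝ)..r, (τ * ((deriv a x) ^ 2 * h x ^ 2) + (1 / (4 * τ)) * (h x ^ 2)⁻¹) := by
      refine intervalIntegral.integral_mono_on hr.1 hac.intervalIntegrable_deriv.abs
        ((hE'.const_mul _).add (hH'.const_mul _)) fun x hx => ?_
      have hx0 := hpos x ⟨hx.1, by linarith [hx.2, hr.2]⟩
      have : τ * ((deriv a x) ^ 2 * h x ^ 2) + (1 / (4 * τ)) * (h x ^ 2)⁻¹ - |deriv a x| =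
        (2 * τ * h x ^ 2 * |deriv a x| - 1) ^ 2 / (4 * τ * h x ^ 2) := by
        rw [← sq_abs (deriv a x)]
        field_simp
        ring
      have h2 : 0 ≤ (2 * τ * h x ^ 2 * |deriv a x| - 1) ^ 2 / (4 * τ * h x ^ 2) := by positivity
      linarith
    refine s3.trans ?_
    rw [intervalIntegral.integral_add (hE'.const_mul _) (hH'.const_mul _),
      intervalIntegral.integral_const_mul, intervalIntegral.integral_const_mul]
    have : η / (4 * τ) = 1 / (4 * τ) * η := by ring
    rw [this]
    gcongr
  have m1 : (∫ x in (0:ℝ)..(R-δ), (a x) ^ 2) ≤ AA R a := by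
    refine intervalIntegral.integral_mono_interval le_rfl (by linarith) (by linarith) ?_ hA
    exact Filter.Eventually.of_forall fun x => by simp only [Pi.zero_apply]; positivity
  refine le_trans ?_ m1
  have := intervalIntegral.integral_mono_on (f := fun _ => 1 - 2 * (τ * C + η / (4 * τ)))
    (by linarith) (by simp) (hA.mono_set (uIcc_subset_uIcc_left hm)) (fun x hx => ?_)
  · rw [intervalIntegral.integral_const, sub_zero, smul_eq_mul] at this
    exact this
  · have h1 := pt x hx
    have h2 := (abs_le.1 h1).1
    nlinarith [sq_nonneg (a x - 1)]

/-- The family of profiles, as a function of `s = R - r`. -/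
noncomputable def prof (R h0 N : ℝ) (s : ℝ) : ℝ :=
  s * (1 + (h0 - R) / R ^ 3 * s ^ 2 + N * (s ^ 2 * (R ^ 2 - s ^ 2)))

lemma prof_base {R : ℝ} (hR : 0 < R) {h0 : ℝ} (hh0 : 0 < h0) {s : ℝ} (hs : s ∈ Icc 0 R) :
    0 < 1 + (h0 - R) / R ^ 3 * s ^ 2 := by
  have : 1 + (h0 - R) / R ^ 3 * s ^ 2 = (R * (R ^ 2 - s ^ 2) + h0 * s ^ 2) / R ^ 3 := by
    field_simp; ring
  rw [this]
  apply div_pos _ (by positivity)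
  have h1 : s ^ 2 ≤ R ^ 2 := pow_le_pow_left₀ hs.1 hs.2 2
  rcases hs.1.eq_or_lt with h | h
  · rw [← h]; simp; positivity
  · have : 0 ≤ R * (R ^ 2 - s ^ 2) := mul_nonneg hR.le (by linarith)
    positivity

lemma prof_contDiff (R h0 N : ℝ) : ContDiff ℝ (⊤ : ℕ∞) (fun r => prof R h0 N (R - r)) := by
  unfold prof; fun_prop

lemma prof_H {R : ℝ} (hR : 0 < R) {h0 : ℝ} (hh0 : 0 < h0) {N : ℝ} (hN : 0 ≤ N) :
    SatisfiesH R (fun r => prof R h0 N (R - r)) := by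
  have hu : UniqueDiffOn ℝ (Icc 0 R) := uniqueDiffOn_Icc hR
  have hRm : R ∈ Icc 0 R := ⟨hR.le, le_rfl⟩
  have hcd := prof_contDiff R h0 N
  refine ⟨hcd.contDiffOn, ?_, by simp [prof], ?_, ?_⟩
  · intro r hr
    have hs : R - r ∈ Icc 0 R := ⟨by linarith [hr.2], by linarith [hr.1]⟩
    have h1 := prof_base hR hh0 hs
    have h2 : (R - r) ^ 2 ≤ R ^ 2 := pow_le_pow_left₀ hs.1 hs.2 2
    have h3 : 0 < R - r := by linarith [hr.2]
    have h4 : 0 ≤ N * ((R - r) ^ 2 * (R ^ 2 - (R - r) ^ 2)) :=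
      mul_nonneg hN (mul_nonneg (sq_nonneg _) (by linarith))
    unfold prof
    positivity
  · rw [(hcd.differentiable (by simp) R).derivWithin (hu R hRm)]
    apply HasDerivAt.deriv
    have h1 : HasDerivAt (fun r : ℝ => R - r) (-1) R := by
      simpa using (hasDerivAt_id R).const_sub R
    have h2 : DifferentiableAt ℝ (fun r : ℝ => 1 + (h0 - R) / R ^ 3 * (R - r) ^ 2 +
      N * ((R - r) ^ 2 * (R ^ 2 - (R - r) ^ 2))) R := by fun_prop
    have h3 := h1.mul h2.hasDerivAt
    have e : (fun r => prof R h0 N (R - r)) = ((fun r => R - r) * fun r =>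
        1 + (h0 - R) / R ^ 3 * (R - r) ^ 2 + N * ((R - r) ^ 2 * (R ^ 2 - (R - r) ^ 2))) := rfl
    rw [e]
    refine h3.congr_deriv ?_
    simp
  · intro k
    rw [iteratedDerivWithin_eq_iteratedDeriv hu (hcd.contDiffAt.of_le (WithTop.coe_le_coe.2 le_top)) hRm,
      iteratedDeriv_comp_const_sub]
    have h1 : (fun x => prof R h0 N (-x)) = -(prof R h0 N) := by
      funext x; simp only [prof, Pi.neg_apply]; ring
    have h2 := iteratedDeriv_comp_neg (2 * k) (prof R h0 N) 0
    rw [h1, iteratedDeriv_neg] at h2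
    simp at h2 ⊢
    linarith

lemma prof_int {R : ℝ} (hR : 0 < R) {h0 : ℝ} (hh0 : 0 < h0) {δ : ℝ} (hδ : 0 < δ) (hδR : δ < R)
    {η : ℝ} (hη : 0 < η) :
    ∃ N : ℝ, 0 ≤ N ∧ ∫ r in (0:ℝ)..(R-δ), ((prof R h0 N (R - r)) ^ 2)⁻¹ ≤ η := by
  have hle : (0:ℝ) ≤ R - δ := by linarith
  have pos : ∀ N, 0 ≤ N → ∀ r ∈ Icc 0 (R-δ), 0 < prof R h0 N (R - r) := fun N hN r hr =>
    (prof_H hR hh0 hN).2.1 r ⟨hr.1, by linarith [hr.2]⟩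
  have cont : ∀ N, 0 ≤ N → ContinuousOn (fun r => ((prof R h0 N (R - r)) ^ 2)⁻¹) (Icc 0 (R-δ)) := by
    intro N hN
    refine ContinuousOn.inv₀ ((prof_contDiff R h0 N).continuous.continuousOn.pow 2) ?_
    intro x hx
    have := pos N hN x hx
    positivity
  have T : Filter.Tendsto (fun N : ℝ => ∫ r in (0:ℝ)..(R-δ), ((prof R h0 N (R - r)) ^ 2)⁻¹)
      Filter.atTop (nhds (∫ r in (0:ℝ)..(R-δ), (0:ℝ))) := by
    apply intervalIntegral.tendsto_integral_filter_of_dominated_convergence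
      (fun r => ((prof R h0 0 (R - r)) ^ 2)⁻¹)
    · filter_upwards [Filter.eventually_ge_atTop 0] with N hN
      rw [uIoc_of_le hle]
      exact ((cont N hN).mono Ioc_subset_Icc_self).aestronglyMeasurable measurableSet_Ioc
    · filter_upwards [Filter.eventually_ge_atTop 0] with N hN
      refine Filter.Eventually.of_forall fun r hr => ?_
      rw [uIoc_of_le hle] at hr
      have hr' := Ioc_subset_Icc_self hr
      have p0 := pos 0 le_rfl r hr'
      have pN := pos N hN r hr'
      rw [Real.norm_eq_abs, abs_of_nonneg (by positivity)]
      have hs : 0 ≤ R - r := by linarith [hr.2]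
      have hs2 : (R - r) ^ 2 ≤ R ^ 2 := pow_le_pow_left₀ hs (by linarith [hr.1]) 2
      gcongr
      unfold prof
      gcongr
    · apply ContinuousOn.intervalIntegrable
      rw [uIcc_of_le hle]
      exact cont 0 le_rfl
    · refine Filter.Eventually.of_forall fun r hr => ?_
      rw [uIoc_of_le hle] at hr
      have hs : 0 < R - r := by linarith [hr.2]
      have hs2 : (R - r) ^ 2 < R ^ 2 := pow_lt_pow_left₀ (by linarith [hr.1]) hs.le two_ne_zero
      apply Filter.Tendsto.inv_tendsto_atTop
      apply (Filter.tendsto_pow_atTop two_ne_zero).comp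
      unfold prof
      apply Filter.Tendsto.const_mul_atTop hs
      apply Filter.tendsto_atTop_add_const_left
      apply Filter.Tendsto.atTop_mul_const _ Filter.tendsto_id
      have : 0 < R ^ 2 - (R - r) ^ 2 := by linarith
      positivity
  rw [intervalIntegral.integral_zero] at T
  obtain ⟨N, h1, h2⟩ := ((T.eventually_le_const hη).and (Filter.eventually_ge_atTop 0)).exists
  exact ⟨N, h2, h1⟩

lemma prof_bound (R h0 N : ℝ) : ∃ K, ∀ r ∈ Icc 0 R, |prof R h0 N (R - r)| ≤ K * (R - r) := by
  have hc : Continuous fun r : ℝ => 1 + (h0 - R) / R ^ 3 * (R - r) ^ 2 +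
      N * ((R - r) ^ 2 * (R ^ 2 - (R - r) ^ 2)) := by fun_prop
  obtain ⟨C, hC⟩ := isCompact_Icc.exists_bound_of_continuousOn (s := Icc 0 R) hc.continuousOn
  refine ⟨C, fun r hr => ?_⟩
  have hs : 0 ≤ R - r := by linarith [hr.2]
  unfold prof
  rw [abs_mul, abs_of_nonneg hs, mul_comm]
  exact mul_le_mul_of_nonneg_right (hC r hr) hs

lemma ray_scale {R : ℝ} (l c : ℝ) (hc : c ≠ 0) (h a : ℝ → ℝ) :
    rayleighQ R 3 l h (fun r => c * a r) = rayleighQ R 3 l h a := by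
  unfold rayleighQ
  have : ∀ r, (deriv (fun r => c * a r) r) ^ 2 * h r ^ (((3:ℕ):ℤ) - 1) +
      l * (c * a r) ^ 2 * h r ^ (((3:ℕ):ℤ) - 3) =
      c ^ 2 * ((deriv a r) ^ 2 * h r ^ (((3:ℕ):ℤ) - 1) + l * (a r) ^ 2 * h r ^ (((3:ℕ):ℤ) - 3)) := by
    intro r
    rw [deriv_const_mul_field]; ring
  simp only [this]
  rw [intervalIntegral.integral_const_mul, mul_pow, mul_assoc, mul_div_mul_left]
  positivity

lemma adm_scale {R : ℝ} {c : ℝ} (hc : c ≠ 0) {a : ℝ → ℝ} (ha : IsAdmissible R a) :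
    IsAdmissible R (fun r => c * a r) := by
  obtain ⟨⟨K, hK⟩, h1, h2⟩ := ha
  refine ⟨⟨‖c‖₊ * K, ?_⟩, by simp [h1], by simp [h2, hc]⟩
  refine LipschitzOnWith.of_dist_le_mul fun x hx y hy => ?_
  have := hK.dist_le_mul x hx y hy
  rw [Real.dist_eq] at this ⊢
  rw [← mul_sub, abs_mul]
  push_cast
  rw [mul_assoc, Real.norm_eq_abs]
  gcongr

lemma lower {R : ℝ} (hR : 0 < R) {h0 : ℝ} (hh0 : 0 < h0) (k : ℕ) {ε : ℝ} (hε : 0 < ε) :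
    ∃ h : ℝ → ℝ, SatisfiesH R h ∧ h 0 = h0 ∧
      steklov R 3 (k + 1) h - steklov R 3 k h >
        R * (sphereEig 3 (k + 1) - sphereEig 3 k) / h0 ^ 2 - ε := by
  have hD := eig_diff k
  have hl := eig_nonneg k
  set D := sphereEig 3 (k + 1) - sphereEig 3 k with hDdef
  set l := sphereEig 3 k with hldef
  set e := ε * h0 ^ 2 / 2 with he
  have he0 : 0 < e := by positivity
  set C := 1 + l * R + D * R with hC
  have hC0 : 0 < C := by positivity
  set δ := min (R / 2) (e / (2 * (D + 1))) with hδ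
  have hδ0 : 0 < δ := by positivity
  have hδR : δ < R := by have : δ ≤ R / 2 := min_le_left _ _; linarith
  have hδD : D * δ ≤ e / 2 := by
    have h1 : δ ≤ e / (2 * (D + 1)) := min_le_right _ _
    rw [le_div_iff₀ (by positivity)] at h1
    nlinarith
  set s := e / (4 * (D + 1) * R) with hs
  have hs0 : 0 < s := by positivity
  have hsD : 2 * D * R * s ≤ e / 2 := by
    have : s * (4 * (D + 1) * R) = e := by rw [hs]; field_simp
    have : 0 < s * R := by positivity
    nlinarith
  set τ := s / (2 * C) with hτ
  have hτ0 : 0 < τ := by positivity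
  obtain ⟨N, hN, hNη⟩ := prof_int hR hh0 hδ0 hδR (η := 2 * τ * s) (by positivity)
  set h : ℝ → ℝ := fun r => prof R h0 N (R - r) with hh
  have hH : SatisfiesH R h := prof_H hR hh0 hN
  have hcont : ContinuousOn h (Icc 0 R) := hH.1.continuousOn
  have h00 : h 0 = h0 := by
    simp only [hh, prof]; field_simp; ring
  refine ⟨h, hH, h00, ?_⟩
  obtain ⟨K, hK⟩ := prof_bound R h0 N
  have hb := stek_bound hR hh0 k hcont h00 hK
  suffices hmain : steklov R 3 k h + (R * D - e) / h0 ^ 2 ≤ steklov R 3 (k+1) h by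
    have : (R * D - e) / h0 ^ 2 = R * D / h0 ^ 2 - ε / 2 := by
      rw [he]; field_simp
    linarith
  apply stek_ge hR
  intro a' ha'
  have hne : (a' 0)⁻¹ ≠ 0 := inv_ne_zero ha'.2.2
  rw [← ray_scale _ _ hne]
  have ha := adm_scale hne ha'
  have ha0 : (fun r => (a' 0)⁻¹ * a' r) 0 = 1 := inv_mul_cancel₀ ha'.2.2
  generalize (fun r => (a' 0)⁻¹ * a' r) = a at ha ha0
  have hl1 : sphereEig 3 (k + 1) = l + D := by rw [hDdef]; ring
  rw [ray_eq hR hcont ha, ha0, h00, hl1, one_pow, one_mul]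
  have hAn := AA_nonneg hR a
  rcases le_total (EE R h a) C with hE | hE
  · have hA := close hR hcont hH.2.1 ha ha0 hδ0 hδR hτ0 hE hNη
    have hk := stek_le hR hcont ha k
    rw [ray_eq hR hcont ha, ha0, h00, one_pow, one_mul] at hk
    have hss : τ * C + 2 * τ * s / (4 * τ) = s := by
      rw [hτ]; field_simp; norm_num
    rw [hss] at hA
    have h1 : R * D - e ≤ D * AA R a := by
      have h2 := mul_le_mul_of_nonneg_left hA hD
      have h3 : 0 ≤ D * δ * s := by positivity
      nlinarith
    calc steklov R 3 k h + (R * D - e) / h0 ^ 2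
        ≤ (EE R h a + l * AA R a) / h0 ^ 2 + (D * AA R a) / h0 ^ 2 := by gcongr
      _ = _ := by ring
  · calc steklov R 3 k h + (R * D - e) / h0 ^ 2
        ≤ (1 + l * R) / h0 ^ 2 + (R * D - e) / h0 ^ 2 := by gcongr
      _ = (1 + l * R + (R * D - e)) / h0 ^ 2 := by ring
      _ ≤ _ := by
        refine div_le_div_of_nonneg_right ?_ (by positivity)
        have : 0 ≤ (l + D) * AA R a := by positivity
        linarith

theorem stmt_7 (R : ℝ) (hR : 0 < R) (h0 : ℝ) (hh0 : 0 < h0) (k : ℕ) :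
    (∀ h : ℝ → ℝ, SatisfiesH R h → h 0 = h0 →
      steklov R 3 (k + 1) h - steklov R 3 k h ≤
        R * (sphereEig 3 (k + 1) - sphereEig 3 k) / h0 ^ 2) ∧
    ∀ ε : ℝ, 0 < ε → ∃ h : ℝ → ℝ, SatisfiesH R h ∧ h 0 = h0 ∧
      steklov R 3 (k + 1) h - steklov R 3 k h >
        R * (sphereEig 3 (k + 1) - sphereEig 3 k) / h0 ^ 2 - ε := by
  refine ⟨fun h hH h00 => upper hR hh0 k hH.1.continuousOn h00, fun ε hε => lower hR hh0 k hε⟩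
end
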